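/- arXiv:1307.2010 — 13 statements merged into one kernel-verified Lean document; each statement's English description precedes it below -/
import Mathlib

section
/- For every n ∈ ℕ and every real x, the row generating polynomials of the GKP array satisfy P_0(x) = 1 and P_{n+1}(x) = x·(β + β'·x)·P_n'(x) + ((n+1)·α + γ + ((n+1)·α' + β' + γ')·x)·P_n(x), where P_n' denotes the derivative of the polynomial P_n. (This is the coefficient form of the partial differential equation −(β+β'x)·x·F_x + (1−α·y−α'·x·y)·F_y = (α+γ+(α'+β'+γ')·x)·F satisfied by the exponential generating function F(x,y) = Σ_{n,k} A(n,k)·x^k·yⁿ/n!.) -/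
/-- An array with recurrence coefficients `a` and `b` that vanishes above the diagonal in row `0`
is lower triangular. -/
theorem eq_zero_of_triangular_recurrence {R : Type*} [NonUnitalNonAssocSemiring R]
    {A a b : ℕ → ℕ → R} (h0 : ∀ k, A 0 (k + 1) = 0)
    (hA : ∀ n k, A (n + 1) (k + 1) = a n k * A n (k + 1) + b n k * A n k)
    {n k : ℕ} (hnk : n < k) : A n k = 0 := by
  induction n generalizing k with
  | zero =>
    obtain ⟨k, rfl⟩ := Nat.exists_eq_add_one.mpr hnk
    exact h0 k
  | succ n ih =>
    obtain ⟨k, rfl⟩ := Nat.exists_eq_add_one.mpr (Nat.zero_lt_of_lt hnk)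
    rw [hA, ih (by omega), ih (by omega), mul_zero, mul_zero, add_zero]

/-- The GKP recurrence |n,k| = (αn+βk+γ)|n-1,k| + (α'n+β'k+γ')|n-1,k-1| + δ_{n0}δ_{k0}.
The row generating polynomials satisfy P_0(x) = 1 and
P_{n+1}(x) = x(β+β'x)P_n'(x) + ((n+1)α+γ+((n+1)α'+β'+γ')x)P_n(x). -/
theorem stmt_0 (α β γ α' β' γ' : ℝ) (A : ℕ → ℕ → ℝ)
    (h00 : A 0 0 = 1)
    (h0k : ∀ k : ℕ, A 0 (k + 1) = 0)
    (hn0 : ∀ n : ℕ, A (n + 1) 0 = (α * (n + 1) + γ) * A n 0)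
    (hnk : ∀ n k : ℕ, A (n + 1) (k + 1) =
      (α * (n + 1) + β * (k + 1) + γ) * A n (k + 1)
        + (α' * (n + 1) + β' * (k + 1) + γ') * A n k)
    (P : ℕ → Polynomial ℝ)
    (hP : ∀ n : ℕ, P n = ∑ k ∈ Finset.range (n + 1), Polynomial.C (A n k) * Polynomial.X ^ k) :
    ∀ (n : ℕ) (x : ℝ),
      (P 0).eval x = 1 ∧
      (P (n + 1)).eval x =
        x * (β + β' * x) * ((Polynomial.derivative (P n)).eval x)
          + (((n : ℝ) + 1) * α + γ + (((n : ℝ) + 1) * α' + β' + γ') * x) * (P n).eval x := by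
  have hcoeff (n k : ℕ) : (P n).coeff k = A n k := by
    rw [hP, Polynomial.finsetSum_coeff]
    simp only [Polynomial.coeff_C_mul_X_pow, Finset.sum_ite_eq, Finset.mem_range]
    split_ifs with h
    · rfl
    · exact (eq_zero_of_triangular_recurrence h0k hnk (by omega)).symm
  have hrec (n : ℕ) : P (n + 1) =
      Polynomial.C β * (Polynomial.derivative (P n) * Polynomial.X)
        + Polynomial.C β' * (Polynomial.derivative (P n) * Polynomial.X * Polynomial.X)
        + Polynomial.C (((n : ℝ) + 1) * α + γ) * P n
        + Polynomial.C (((n : ℝ) + 1) * α' + β' + γ') * (P n * Polynomial.X) := by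
    ext k
    simp only [Polynomial.coeff_add, Polynomial.coeff_C_mul]
    rcases k with _ | _ | k
    · simp only [Polynomial.coeff_mul_X_zero, hcoeff, hn0]
      ring
    · simp only [Polynomial.coeff_mul_X, Polynomial.coeff_mul_X_zero,
        Polynomial.coeff_derivative, hcoeff, hnk]
      push_cast
      ring
    · simp only [Polynomial.coeff_mul_X, Polynomial.coeff_derivative, hcoeff, hnk]
      push_cast
      ring
  refine fun n x => ⟨by simp [hP, h00], ?_⟩
  rw [hrec]
  simp only [Polynomial.eval_add, Polynomial.eval_mul, Polynomial.eval_C, Polynomial.eval_X]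
  ring
end

section
/- Let A be the GKP array with parameters (α,β,γ;α',β',γ'), and define the reversed array A*(n,k) := A(n, n−k) for 0 ≤ k ≤ n and A*(n,k) := 0 for k > n. Then A* is exactly the GKP array with parameters (α'+β', −β', γ'; α+β, −β, γ); i.e., A* satisfies A*(0,0)=1, A*(0,k)=0 for k≥1, and A*(n,k) = ((α'+β')·n − β'·k + γ')·A*(n−1,k) + ((α+β)·n − β·k + γ)·A*(n−1,k−1) for n ≥ 1 (with the term A*(n−1,k−1) absent when k = 0). -/
/-- A two-index array supported at `k = 0` in row `0` and obeying a triangular recurrence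
vanishes above the diagonal. -/
theorem triangular_eq_zero_of_lt {R : Type*} [Semiring R] (A a b : ℕ → ℕ → R)
    (h0k : ∀ k : ℕ, A 0 (k + 1) = 0)
    (hnk : ∀ n k : ℕ, A (n + 1) (k + 1) = a n k * A n (k + 1) + b n k * A n k) :
    ∀ {n k : ℕ}, n < k → A n k = 0
  | 0, k + 1, _ => h0k k
  | n + 1, k + 1, h => by
    rw [hnk, triangular_eq_zero_of_lt A a b h0k hnk (show n < k + 1 by omega),
      triangular_eq_zero_of_lt A a b h0k hnk (show n < k by omega)]
    simp

/-- The reversed array A*(n,k) = A(n,n−k) (0 for k > n) is the GKP array with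
parameters (α'+β', −β', γ'; α+β, −β, γ). -/
theorem stmt_2 (α β γ α' β' γ' : ℝ) (A : ℕ → ℕ → ℝ)
    (h00 : A 0 0 = 1)
    (h0k : ∀ k : ℕ, A 0 (k + 1) = 0)
    (hn0 : ∀ n : ℕ, A (n + 1) 0 = (α * (n + 1) + γ) * A n 0)
    (hnk : ∀ n k : ℕ, A (n + 1) (k + 1) =
      (α * (n + 1) + β * (k + 1) + γ) * A n (k + 1)
        + (α' * (n + 1) + β' * (k + 1) + γ') * A n k)
    (Astar : ℕ → ℕ → ℝ)
    (hAstar : ∀ n k : ℕ, Astar n k = if k ≤ n then A n (n - k) else 0) :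
    Astar 0 0 = 1 ∧
    (∀ k : ℕ, Astar 0 (k + 1) = 0) ∧
    (∀ n : ℕ, Astar (n + 1) 0 = ((α' + β') * (n + 1) + γ') * Astar n 0) ∧
    (∀ n k : ℕ, Astar (n + 1) (k + 1) =
      ((α' + β') * (n + 1) - β' * (k + 1) + γ') * Astar n (k + 1)
        + ((α + β) * (n + 1) - β * (k + 1) + γ) * Astar n k) := by
  have hvanish (n : ℕ) : A n (n + 1) = 0 :=
    triangular_eq_zero_of_lt A _ _ h0k hnk n.lt_succ_self
  have hle (m k : ℕ) : Astar (k + m) k = A (k + m) m := by simp [hAstar]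
  have hlt {n k : ℕ} (h : n < k) : Astar n k = 0 := by simp [hAstar, h]
  refine ⟨by simp [hAstar, h00], fun k => hlt k.succ_pos, fun n => ?_, fun n k => ?_⟩
  · simp only [hAstar, Nat.zero_le, if_true, Nat.sub_zero, hnk, hvanish]
    ring
  · rcases lt_or_ge n k with h | h
    · rw [hlt (show n + 1 < k + 1 by omega), hlt (show n < k + 1 by omega), hlt h]
      ring
    · obtain ⟨m, rfl⟩ := Nat.exists_eq_add_of_le h
      rw [hle, show k + m + 1 = k + 1 + m by ring, hle]
      cases m with
      | zero =>
        simp only [Nat.add_zero, hlt k.lt_succ_self, hn0]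
        ring
      | succ j =>
        rw [show k + (j + 1) = k + 1 + j by ring, hle,
          show k + 1 + (j + 1) = k + 1 + j + 1 by ring, hnk]
        push_cast
        ring
end

section
/- Suppose the parameters satisfy (α', β', γ') = (α+β, −β, γ), i.e., A is the GKP array with parameters (α, β, γ; α+β, −β, γ). Then the array is self-dual (symmetric): A(n, k) = A(n, n−k) for every n ∈ ℕ and every 0 ≤ k ≤ n. -/
/-- The GKP array with parameters (α, β, γ; α+β, −β, γ) is self-dual (symmetric):
A(n,k) = A(n,n−k) for 0 ≤ k ≤ n. -/
theorem stmt_4 (α β γ : ℝ) (A : ℕ → ℕ → ℝ)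
    (h00 : A 0 0 = 1)
    (h0k : ∀ k : ℕ, A 0 (k + 1) = 0)
    (hn0 : ∀ n : ℕ, A (n + 1) 0 = (α * (n + 1) + γ) * A n 0)
    (hnk : ∀ n k : ℕ, A (n + 1) (k + 1) =
      (α * (n + 1) + β * (k + 1) + γ) * A n (k + 1)
        + ((α + β) * (n + 1) + (-β) * (k + 1) + γ) * A n k) :
    ∀ n k : ℕ, k ≤ n → A n k = A n (n - k) := by
  have hzero : ∀ n k : ℕ, n < k → A n k = 0 := by
    intro n
    induction n with
    | zero =>
      rintro (_ | k) hk
      · omega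
      · exact h0k k
    | succ n ih =>
      rintro (_ | k) hk
      · omega
      · rw [hnk, ih (k + 1) (by omega), ih k (by omega), mul_zero, mul_zero, add_zero]
  have hedge : ∀ n : ℕ, A (n + 1) (n + 1) = (α * (n + 1) + γ) * A n n := by
    intro n
    rw [hnk, hzero n (n + 1) n.lt_succ_self]
    ring
  have hsymm : ∀ n i j : ℕ, i + j = n → A n i = A n j := by
    intro n
    induction n with
    | zero =>
      intro i j h
      rw [show i = j by omega]
    | succ n ih =>
      rintro (_ | i) (_ | j) h
      · rfl
      · obtain rfl : j = n := by omega
        rw [hn0, hedge, ih 0 j (zero_add j)]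
      · obtain rfl : i = n := by omega
        rw [hn0, hedge, ih i 0 (add_zero i)]
      · obtain rfl : i + j + 1 = n := by omega
        rw [hnk _ i, hnk _ j, ih (i + 1) j (by omega), ih i (j + 1) (by omega)]
        push_cast
        ring
  intro n k hk
  exact hsymm n k (n - k) (Nat.add_sub_of_le hk)
end

section
/- Let α, ρ, G, H be real numbers with G ≠ 0, and let A be the GKP array with parameters (α, β, γ; α', β', γ') = (α, α+ρG, G−α; −ρH, ρH+αH/G, H−αH/G). Then for every n ∈ ℕ and every 0 ≤ k ≤ n, A(n,k) = C(n,k)·(H/G)^k·Π_{j=0}^{n−1}(G+α·j), where C(n,k) is the binomial coefficient. In particular A(n,k) does not depend on ρ: all parameter choices in this one-parameter family produce the same array. -/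
/-- The absorption identity for binomial coefficients, with the subtraction taken in `ℝ`. -/
theorem cast_choose_succ_mul (n k : ℕ) :
    (n.choose (k + 1) : ℝ) * (k + 1) = n.choose k * ((n : ℝ) - k) := by
  rcases le_or_gt k n with h | h
  · rw [← Nat.cast_sub h]
    exact_mod_cast Nat.choose_succ_right_eq n k
  · simp [Nat.choose_eq_zero_of_lt h, Nat.choose_eq_zero_of_lt (Nat.lt_succ_of_lt h)]

/-- For the degenerate family (α, α+ρG, G−α; −ρH, ρH+αH/G, H−αH/G), the GKP array is
A(n,k) = C(n,k)(H/G)^k Π_{j=0}^{n−1}(G+αj), independently of ρ. -/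
theorem stmt_6 (α ρ G H : ℝ) (hG : G ≠ 0) (A : ℕ → ℕ → ℝ)
    (h00 : A 0 0 = 1)
    (h0k : ∀ k : ℕ, A 0 (k + 1) = 0)
    (hn0 : ∀ n : ℕ, A (n + 1) 0 = (α * (n + 1) + (G - α)) * A n 0)
    (hnk : ∀ n k : ℕ, A (n + 1) (k + 1) =
      (α * (n + 1) + (α + ρ * G) * (k + 1) + (G - α)) * A n (k + 1)
        + ((-(ρ * H)) * (n + 1) + (ρ * H + α * H / G) * (k + 1) + (H - α * H / G)) * A n k) :
    ∀ n k : ℕ, k ≤ n →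
      A n k = (n.choose k : ℝ) * (H / G) ^ k * ∏ j ∈ Finset.range n, (G + α * j) := by
  suffices h : ∀ n k : ℕ,
      A n k = (n.choose k : ℝ) * (H / G) ^ k * ∏ j ∈ Finset.range n, (G + α * j) from
    fun n k _ => h n k
  intro n
  induction n with
  | zero =>
    rintro (_ | k)
    · simp [h00]
    · simp [h0k]
  | succ n ih =>
    rintro (_ | k)
    · rw [hn0, ih, Finset.prod_range_succ]
      simp only [Nat.choose_zero_right, Nat.cast_one, pow_zero]
      ring
    · have hc := cast_choose_succ_mul n k
      rw [hnk, ih, ih, Finset.prod_range_succ, Nat.choose_succ_succ, Nat.cast_add]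
      generalize (∏ j ∈ Finset.range n, (G + α * j)) = P
      obtain ⟨r, rfl⟩ : ∃ r, H = r * G := ⟨H / G, (div_mul_cancel₀ H hG).symm⟩
      rw [← mul_assoc α r G, mul_div_cancel_right₀ _ hG, mul_div_cancel_right₀ _ hG]
      linear_combination (α + ρ * G) * r ^ (k + 1) * P * hc
end

section
/- Suppose β = −α and γ = −α (with α, α', β', γ' arbitrary reals), i.e., A is the GKP array with parameters (α, −α, −α; α', β', γ'). Then A(n,k) = 0 whenever k ≠ n, and A(n,n) = Π_{j=1}^{n}(γ' + (α'+β')·j) for every n ∈ ℕ. In particular the array depends only on L := α'+β' and γ', and not on α or on the individual values of α' and β'. -/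
/-- For the degenerate family (α, −α, −α; α', β', γ'), the GKP array is diagonal:
A(n,k) = 0 for k ≠ n and A(n,n) = Π_{j=1}^n (γ' + (α'+β')j). -/
theorem stmt_7 (α α' β' γ' : ℝ) (A : ℕ → ℕ → ℝ)
    (h00 : A 0 0 = 1)
    (h0k : ∀ k : ℕ, A 0 (k + 1) = 0)
    (hn0 : ∀ n : ℕ, A (n + 1) 0 = (α * (n + 1) + (-α)) * A n 0)
    (hnk : ∀ n k : ℕ, A (n + 1) (k + 1) =
      (α * (n + 1) + (-α) * (k + 1) + (-α)) * A n (k + 1)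
        + (α' * (n + 1) + β' * (k + 1) + γ') * A n k) :
    (∀ n k : ℕ, k ≠ n → A n k = 0) ∧
    (∀ n : ℕ, A n n = ∏ j ∈ Finset.range n, (γ' + (α' + β') * (j + 1))) := by
  have hoff : ∀ n k : ℕ, k ≠ n → A n k = 0 := by
    intro n
    induction n with
    | zero =>
      intro k hk
      obtain ⟨k, rfl⟩ := Nat.exists_eq_succ_of_ne_zero hk
      exact h0k k
    | succ n ih =>
      rintro (_ | k) hk
      · rw [hn0]
        rcases eq_or_ne 0 n with rfl | hn
        · simp
        · rw [ih 0 hn, mul_zero]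
      · rw [hnk, ih k (by omega), mul_zero, add_zero]
        rcases eq_or_ne (k + 1) n with rfl | hn
        · push_cast
          ring
        · rw [ih (k + 1) hn, mul_zero]
  refine ⟨hoff, fun n => ?_⟩
  induction n with
  | zero => simpa using h00
  | succ n ih =>
    rw [hnk, hoff n (n + 1) (by omega), ih, Finset.prod_range_succ]
    ring
end

section
/- (Type IV exponential generating function, non-degenerate case.) Assume β = β' = 0. Let x, y be real numbers such that a := α + α'·x ≠ 0 and |a·y| < 1. Then the series Σ_{n≥0} P_n(x)·yⁿ/n! converges, with sum equal to the real power (1 − a·y) ^ ( −(α + γ + (α'+γ')·x)/a ) (Real.rpow of the positive base 1 − a·y). -/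
open Finset in
/-- With `β = β' = 0`, the row polynomials satisfy a first-order recurrence in `n`. -/
theorem row_sum_succ {A : ℕ → ℕ → ℝ} {α γ α' γ' : ℝ}
    (h0k : ∀ k : ℕ, A 0 (k + 1) = 0)
    (hn0 : ∀ n : ℕ, A (n + 1) 0 = (α * (n + 1) + γ) * A n 0)
    (hnk : ∀ n k : ℕ, A (n + 1) (k + 1) =
      (α * (n + 1) + γ) * A n (k + 1) + (α' * (n + 1) + γ') * A n k) (x : ℝ) (n : ℕ) :
    ∑ k ∈ range (n + 2), A (n + 1) k * x ^ k =
      ((α + α' * x) * (n + 1) + (γ + γ' * x)) * ∑ k ∈ range (n + 1), A n k * x ^ k := by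
  have hzero : ∀ n k : ℕ, n < k → A n k = 0 := by
    intro n
    induction n with
    | zero =>
      rintro (_ | k) hk
      · exact absurd hk (lt_irrefl 0)
      · exact h0k k
    | succ n ih =>
      rintro (_ | k) hk
      · omega
      · rw [hnk, ih _ (by omega), ih _ (by omega)]
        ring
  have hshift : ∑ k ∈ range (n + 1), A n (k + 1) * x ^ (k + 1) + A n 0 =
      ∑ k ∈ range (n + 1), A n k * x ^ k := by
    have h := sum_range_succ' (fun k => A n k * x ^ k) (n + 1)
    rw [sum_range_succ, hzero n (n + 1) (by omega)] at h
    simpa using h.symm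
  have hsplit : ∑ k ∈ range (n + 1), A (n + 1) (k + 1) * x ^ (k + 1) =
      (α * (n + 1) + γ) * ∑ k ∈ range (n + 1), A n (k + 1) * x ^ (k + 1) +
        (α' * (n + 1) + γ') * x * ∑ k ∈ range (n + 1), A n k * x ^ k := by
    rw [mul_sum, mul_sum, ← sum_add_distrib]
    refine sum_congr rfl fun k _ => ?_
    rw [hnk]
    ring
  rw [sum_range_succ', hsplit, hn0]
  linear_combination (α * (n + 1) + γ) * hshift

/-- The exponential generating function of the products `p n = ∏ j < n, a * (s + j)`. -/
theorem hasSum_one_sub_rpow_neg {a s y : ℝ} {p : ℕ → ℝ} (hp0 : p 0 = 1)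
    (hp : ∀ n : ℕ, p (n + 1) = a * (s + n) * p n) (hy : |a * y| < 1) :
    HasSum (fun n : ℕ => p n * y ^ n / n.factorial) ((1 - a * y) ^ (-s)) := by
  have hp_eq : ∀ n : ℕ, p n = a ^ n * (ascPochhammer ℝ n).eval s := by
    intro n
    induction n with
    | zero => simp [hp0]
    | succ n ih =>
      rw [hp, ih, ascPochhammer_succ_eval]
      ring
  have hball : a * y ∈ Metric.eball (0 : ℝ) 1 := by
    rw [Metric.mem_eball, edist_dist, Real.dist_eq, sub_zero]
    exact ENNReal.ofReal_lt_one.mpr hy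
  have h := (Real.one_div_one_sub_rpow_hasFPowerSeriesOnBall_zero s).hasSum hball
  have hpos : 0 < 1 - a * y := by linarith [(abs_lt.mp hy).2]
  rw [zero_add, one_div, ← Real.rpow_neg hpos.le] at h
  refine h.congr_fun fun n => ?_
  have hfact : (n.factorial : ℝ) ≠ 0 := by exact_mod_cast n.factorial_ne_zero
  have hchoose := Ring.factorial_nsmul_multichoose_eq_ascPochhammer s n
  rw [Ring.multichoose_eq, Polynomial.ascPochhammer_smeval_eq_eval, nsmul_eq_mul] at hchoose
  rw [hp_eq, ← hchoose, FormalMultilinearSeries.ofScalars_apply_eq, smul_eq_mul, mul_pow]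
  field_simp

/-- Type IV EGF, non-degenerate case: if β = β' = 0, a = α + α'x ≠ 0 and |ay| < 1, then
Σ P_n(x) yⁿ/n! = (1 − ay)^(−(α+γ+(α'+γ')x)/a) (real power). -/
theorem stmt_9 (α β γ α' β' γ' : ℝ) (hβ : β = 0) (hβ' : β' = 0) (A : ℕ → ℕ → ℝ)
    (h00 : A 0 0 = 1)
    (h0k : ∀ k : ℕ, A 0 (k + 1) = 0)
    (hn0 : ∀ n : ℕ, A (n + 1) 0 = (α * (n + 1) + γ) * A n 0)
    (hnk : ∀ n k : ℕ, A (n + 1) (k + 1) =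
      (α * (n + 1) + β * (k + 1) + γ) * A n (k + 1)
        + (α' * (n + 1) + β' * (k + 1) + γ') * A n k)
    (x y : ℝ) (ha : α + α' * x ≠ 0) (hy : |(α + α' * x) * y| < 1) :
    HasSum
      (fun n : ℕ => (∑ k ∈ Finset.range (n + 1), A n k * x ^ k) * y ^ n / n.factorial)
      (Real.rpow (1 - (α + α' * x) * y)
        (-(α + γ + (α' + γ') * x) / (α + α' * x))) := by
  subst hβ hβ'
  refine (neg_div (α + α' * x) (α + γ + (α' + γ') * x)) ▸ hasSum_one_sub_rpow_neg
    (p := fun n => ∑ k ∈ Finset.range (n + 1), A n k * x ^ k) (by simp [h00]) (fun n => ?_) hy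
  rw [row_sum_succ h0k hn0 (by simpa using hnk)]
  field_simp
  ring
end

section
/- (Row polynomials of Type IV.) Assume β = β' = 0. Then for every n ∈ ℕ and every real x, P_n(x) = Π_{k=1}^{n} (k·α + γ + (k·α' + γ')·x); equivalently this identity holds in the polynomial ring ℝ[x]. -/
/-- A triangular array whose zeroth row is supported at `0`, and in which each entry of a row is a
linear combination of the entries above and above-left, vanishes above the diagonal. -/
theorem eq_zero_of_lt_of_triangular_recurrence {R : Type*} [Semiring R] {A a b : ℕ → ℕ → R}
    (h0 : ∀ k, A 0 (k + 1) = 0)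
    (hA : ∀ n k, A (n + 1) (k + 1) = a n k * A n (k + 1) + b n k * A n k)
    {n k : ℕ} (h : n < k) : A n k = 0 := by
  induction n generalizing k with
  | zero =>
    obtain ⟨k, rfl⟩ := Nat.exists_eq_succ_of_ne_zero h.ne'
    exact h0 k
  | succ n ih =>
    obtain ⟨k, rfl⟩ := Nat.exists_eq_succ_of_ne_zero (Nat.ne_zero_of_lt h)
    simp [hA, ih (k := k) (by omega), ih (k := k + 1) (by omega)]

/-- Row polynomials of Type IV: if β = β' = 0 then
P_n(x) = Π_{k=1}^n (kα + γ + (kα' + γ')x). -/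
theorem stmt_11 (α β γ α' β' γ' : ℝ) (hβ : β = 0) (hβ' : β' = 0) (A : ℕ → ℕ → ℝ)
    (h00 : A 0 0 = 1)
    (h0k : ∀ k : ℕ, A 0 (k + 1) = 0)
    (hn0 : ∀ n : ℕ, A (n + 1) 0 = (α * (n + 1) + γ) * A n 0)
    (hnk : ∀ n k : ℕ, A (n + 1) (k + 1) =
      (α * (n + 1) + β * (k + 1) + γ) * A n (k + 1)
        + (α' * (n + 1) + β' * (k + 1) + γ') * A n k) :
    ∀ (n : ℕ) (x : ℝ),
      (∑ k ∈ Finset.range (n + 1), A n k * x ^ k) =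
        ∏ k ∈ Finset.range n, (((k : ℝ) + 1) * α + γ + (((k : ℝ) + 1) * α' + γ') * x) := by
  subst hβ hβ'
  intro n x
  induction n with
  | zero => simp [h00]
  | succ n ih =>
    have hshift : ∑ k ∈ Finset.range (n + 1), A n (k + 1) * x ^ (k + 1) + A n 0 =
        ∑ k ∈ Finset.range (n + 1), A n k * x ^ k := by
      have h := Finset.sum_range_succ' (fun k => A n k * x ^ k) (n + 1)
      rw [Finset.sum_range_succ, eq_zero_of_lt_of_triangular_recurrence h0k hnk n.lt_succ_self] at h
      simpa using h.symm
    have hsum : ∑ k ∈ Finset.range (n + 1), A (n + 1) (k + 1) * x ^ (k + 1) =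
        (α * (n + 1) + γ) * ∑ k ∈ Finset.range (n + 1), A n (k + 1) * x ^ (k + 1) +
          (α' * (n + 1) + γ') * x * ∑ k ∈ Finset.range (n + 1), A n k * x ^ k := by
      rw [Finset.mul_sum, Finset.mul_sum, ← Finset.sum_add_distrib]
      refine Finset.sum_congr rfl fun k _ => ?_
      rw [hnk]
      ring
    rw [Finset.prod_range_succ, ← ih, Finset.sum_range_succ', hsum, hn0]
    linear_combination (α * (n + 1) + γ) * hshift
end

section
/- (Explicit coefficients of Type IV.) Assume β = β' = 0. Then for every n ∈ ℕ and every 0 ≤ k ≤ n, A(n,k) = Σ_{t=0}^{n} Σ_{s=0}^{k} c(n,t)·C(t,s)·C(n−t, k−s)·(α+γ)^{t−s}·(α'+γ')^{s}·α^{n−t+s−k}·(α')^{k−s}, where C denotes the usual binomial coefficient, summands with s > t or k−s > n−t vanish because their binomial coefficients are zero (so all exponents may be taken as natural numbers), and the convention 0^0 = 1 is used. -/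
open Polynomial in
theorem sum_coeff_ascPochhammer_mul_pow_mul_pow {R : Type*} [CommSemiring R] (p q : R) (n : ℕ) :
    ∑ t ∈ Finset.range (n + 1), ((ascPochhammer ℕ n).coeff t : R) * p ^ t * q ^ (n - t) =
      ∏ i ∈ Finset.range n, (p + i * q) := by
  induction n with
  | zero => simp
  | succ n ih =>
    have h0 : (ascPochhammer ℕ (n + 1)).coeff 0 = n * (ascPochhammer ℕ n).coeff 0 := by
      rw [ascPochhammer_succ_right, mul_add, ← C_eq_natCast, coeff_add, coeff_mul_C]
      simp [mul_comm]
    have hs (t : ℕ) : (ascPochhammer ℕ (n + 1)).coeff (t + 1) =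
        (ascPochhammer ℕ n).coeff t + n * (ascPochhammer ℕ n).coeff (t + 1) := by
      rw [ascPochhammer_succ_right, mul_add, ← C_eq_natCast, coeff_add, coeff_mul_C, coeff_mul_X]
      simp [mul_comm]
    have htop : (ascPochhammer ℕ n).coeff (n + 1) = 0 :=
      coeff_eq_zero_of_natDegree_lt (by rw [ascPochhammer_natDegree]; omega)
    have hq : ∑ t ∈ Finset.range (n + 1),
          ((ascPochhammer ℕ n).coeff (t + 1) : R) * p ^ (t + 1) * q ^ (n - t) +
        ((ascPochhammer ℕ n).coeff 0 : R) * q ^ (n + 1) =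
        q * ∏ i ∈ Finset.range n, (p + i * q) := by
      rw [← ih, Finset.mul_sum]
      trans ∑ t ∈ Finset.range (n + 2),
        ((ascPochhammer ℕ n).coeff t : R) * p ^ t * q ^ (n + 1 - t)
      · rw [Finset.sum_range_succ' _ (n + 1)]
        simp
      · rw [Finset.sum_range_succ, htop]
        simp only [Nat.cast_zero, zero_mul, add_zero]
        refine Finset.sum_congr rfl fun t ht => ?_
        rw [Nat.sub_add_comm (Finset.mem_range_succ_iff.mp ht), pow_succ]
        ring
    have hp : ∑ t ∈ Finset.range (n + 1),
          ((ascPochhammer ℕ n).coeff t : R) * p ^ (t + 1) * q ^ (n - t) =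
        p * ∏ i ∈ Finset.range n, (p + i * q) := by
      rw [← ih, Finset.mul_sum]
      exact Finset.sum_congr rfl fun t _ => by ring
    rw [Finset.prod_range_succ, Finset.sum_range_succ', mul_add, mul_comm _ p,
      mul_left_comm _ (n : R) q, mul_comm _ q, ← hp, ← hq, mul_add, Finset.mul_sum,
      ← add_assoc, ← Finset.sum_add_distrib, h0]
    congr 1
    · refine Finset.sum_congr rfl fun t _ => ?_
      rw [hs, Nat.add_sub_add_right]
      push_cast
      ring
    · push_cast
      simp [mul_assoc]

open Polynomial in
theorem coeff_C_add_C_mul_X_pow {R : Type*} [CommSemiring R] (a b : R) (m k : ℕ) :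
    ((C a + C b * X) ^ m).coeff k = m.choose k * a ^ (m - k) * b ^ k := by
  have h : (C a + C b * X) ^ m = ((X + C a) ^ m).comp (C b * X) := by
    simp [add_comm]
  rw [h, comp_C_mul_X_coeff, coeff_X_add_C_pow]
  ring

open Polynomial in
theorem coeff_prod_of_recurrence {R : Type*} [CommSemiring R] (a b : ℕ → R) (A : ℕ → ℕ → R)
    (h00 : A 0 0 = 1) (h0k : ∀ k, A 0 (k + 1) = 0) (hn0 : ∀ n, A (n + 1) 0 = a n * A n 0)
    (hnk : ∀ n k, A (n + 1) (k + 1) = a n * A n (k + 1) + b n * A n k) (n k : ℕ) :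
    (∏ i ∈ Finset.range n, (C (a i) + C (b i) * X)).coeff k = A n k := by
  induction n generalizing k with
  | zero => cases k <;> simp [h00, h0k, coeff_one]
  | succ n ih =>
    rw [Finset.prod_range_succ_comm, add_mul, mul_assoc, coeff_add, coeff_C_mul, coeff_C_mul, ih]
    cases k with
    | zero => simp [hn0]
    | succ k => rw [coeff_X_mul, ih, hnk]

/-- Explicit coefficients of Type IV: if β = β' = 0 then
A(n,k) = Σ_t Σ_s c(n,t) C(t,s) C(n−t,k−s) (α+γ)^{t−s} (α'+γ')^s α^{n−t+s−k} α'^{k−s},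
where c(n,t) is the coefficient of X^t in the ascending factorial x(x+1)⋯(x+n−1). -/
theorem stmt_12 (α β γ α' β' γ' : ℝ) (hβ : β = 0) (hβ' : β' = 0) (A : ℕ → ℕ → ℝ)
    (h00 : A 0 0 = 1)
    (h0k : ∀ k : ℕ, A 0 (k + 1) = 0)
    (hn0 : ∀ n : ℕ, A (n + 1) 0 = (α * (n + 1) + γ) * A n 0)
    (hnk : ∀ n k : ℕ, A (n + 1) (k + 1) =
      (α * (n + 1) + β * (k + 1) + γ) * A n (k + 1)
        + (α' * (n + 1) + β' * (k + 1) + γ') * A n k) :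
    ∀ n k : ℕ, k ≤ n →
      A n k = ∑ t ∈ Finset.range (n + 1), ∑ s ∈ Finset.range (k + 1),
        ((ascPochhammer ℕ n).coeff t : ℝ) * (t.choose s : ℝ) * ((n - t).choose (k - s) : ℝ)
          * (α + γ) ^ (t - s) * (α' + γ') ^ s * α ^ (n - t + s - k) * α' ^ (k - s) := by
  intro n k _
  subst hβ hβ'
  have hA := coeff_prod_of_recurrence (fun i : ℕ => α * (i + 1) + γ)
    (fun i : ℕ => α' * (i + 1) + γ') A h00 h0k hn0 (fun n k => by rw [hnk]; ring) n k
  have hprod : ∏ i ∈ Finset.range n, (Polynomial.C (α * ((i : ℝ) + 1) + γ) +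
        Polynomial.C (α' * ((i : ℝ) + 1) + γ') * Polynomial.X) =
      ∏ i ∈ Finset.range n, ((Polynomial.C (α + γ) + Polynomial.C (α' + γ') * Polynomial.X) +
        (i : Polynomial ℝ) * (Polynomial.C α + Polynomial.C α' * Polynomial.X)) := by
    refine Finset.prod_congr rfl fun i _ => ?_
    simp only [Polynomial.C_add, Polynomial.C_mul, Polynomial.C_1, map_natCast]
    ring
  rw [← hA, hprod, ← sum_coeff_ascPochhammer_mul_pow_mul_pow, Polynomial.finsetSum_coeff]
  refine Finset.sum_congr rfl fun t _ => ?_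
  rw [mul_assoc, ← Polynomial.C_eq_natCast, Polynomial.coeff_C_mul, Polynomial.coeff_mul,
    Finset.Nat.sum_antidiagonal_eq_sum_range_succ_mk, Finset.mul_sum]
  refine Finset.sum_congr rfl fun s hs => ?_
  have hsk : s ≤ k := Finset.mem_range_succ_iff.mp hs
  rw [coeff_C_add_C_mul_X_pow, coeff_C_add_C_mul_X_pow,
    show n - t - (k - s) = n - t + s - k by omega]
  ring
end

section
/- Assume β ≠ 0 and β' = 0. Then for every x > 0 the series defining Q converges, and Q is differentiable at x with derivative Q'(x) = (1/β)·x^{−α/β−1}·exp(−α'·x/β) (HasDerivAt, with x^{−α/β−1} the real power). In particular Q'(x) ≠ 0 for all x > 0, so Q is strictly monotone and injective on (0,∞). -/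
open Real in
/-- The primitive on `(0, ∞)` of the `k`-th term of the power series expansion of
`b⁻¹ * y ^ (-a - 1) * exp (c * y)`. -/
noncomputable def rpowExpPrimitiveTerm (a b c : ℝ) (k : ℕ) (y : ℝ) : ℝ :=
  if (k : ℝ) = a then c ^ k / ((k.factorial : ℝ) * b) * log y
  else c ^ k / ((k.factorial : ℝ) * b) * y ^ ((k : ℝ) - a) / ((k : ℝ) - a)

theorem hasDerivAt_rpowExpPrimitiveTerm (a b c : ℝ) (k : ℕ) {y : ℝ} (hy : 0 < y) :
    HasDerivAt (rpowExpPrimitiveTerm a b c k)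
      (1 / b * y ^ (-a - 1) * ((c * y) ^ k / (k.factorial : ℝ))) y := by
  have hpow : y ^ ((k : ℝ) - a - 1) = y ^ k * y ^ (-a - 1) := by
    rw [← Real.rpow_natCast, ← Real.rpow_add hy]
    ring_nf
  unfold rpowExpPrimitiveTerm
  split_ifs with h
  · refine ((Real.hasDerivAt_log hy.ne').const_mul
      (c ^ k / ((k.factorial : ℝ) * b))).congr_deriv ?_
    rw [← Real.rpow_neg_one, show (-1 : ℝ) = (k : ℝ) - a - 1 by rw [h]; ring, hpow, mul_pow]
    ring
  · have hk : (k : ℝ) - a ≠ 0 := sub_ne_zero.mpr h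
    refine (((Real.hasDerivAt_rpow_const (p := (k : ℝ) - a) (Or.inl hy.ne')).const_mul
      (c ^ k / ((k.factorial : ℝ) * b))).div_const ((k : ℝ) - a)).congr_deriv ?_
    rw [hpow, mul_left_comm, mul_div_cancel_left₀ _ hk, mul_pow]
    ring

theorem summable_rpowExpPrimitiveTerm (a b c : ℝ) {y : ℝ} (hy : 0 < y) :
    Summable fun k ↦ rpowExpPrimitiveTerm a b c k y := by
  refine Summable.of_norm_bounded_eventually_nat
    ((Real.summable_pow_div_factorial |c * y|).mul_left |1 / b * y ^ (-a)|) ?_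
  filter_upwards [Filter.eventually_ge_atTop ⌈a + 1⌉₊] with k hk
  have hk1 : 1 ≤ (k : ℝ) - a := by linarith [Nat.ceil_le.mp hk]
  have hpow : y ^ ((k : ℝ) - a) = y ^ k * y ^ (-a) := by
    rw [← Real.rpow_natCast, ← Real.rpow_add hy, sub_eq_add_neg]
  rw [rpowExpPrimitiveTerm, if_neg (by linarith), hpow, Real.norm_eq_abs, abs_div,
    abs_of_pos (by linarith : 0 < (k : ℝ) - a)]
  refine (div_le_self (abs_nonneg _) hk1).trans_eq ?_
  rw [← abs_pow, ← Nat.abs_cast k.factorial, ← abs_div, ← abs_mul, Nat.abs_cast, mul_pow]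
  congr 1
  ring

theorem hasDerivAt_tsum_rpowExpPrimitiveTerm (a b c : ℝ) {x : ℝ} (hx : 0 < x) :
    HasDerivAt (fun y ↦ ∑' k, rpowExpPrimitiveTerm a b c k y)
      (1 / b * x ^ (-a - 1) * Real.exp (c * x)) x := by
  have hpos : ∀ y ∈ Set.Icc (x / 2) (2 * x), 0 < y := fun y hy ↦ by linarith [hy.1]
  obtain ⟨M, hM⟩ := (isCompact_Icc (a := x / 2) (b := 2 * x)).exists_bound_of_continuousOn
    (f := fun y : ℝ ↦ 1 / b * y ^ (-a - 1)) (continuousOn_const.mul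
      (continuousOn_id.rpow_const fun y hy ↦ Or.inl (hpos y hy).ne'))
  have hxmem : x ∈ Set.Ioo (x / 2) (2 * x) := ⟨by linarith, by linarith⟩
  have key := hasDerivAt_tsum_of_isPreconnected
    ((Real.summable_pow_div_factorial (|c| * (2 * x))).mul_left M)
    isOpen_Ioo isPreconnected_Ioo
    (fun k y hy ↦ hasDerivAt_rpowExpPrimitiveTerm a b c k (hpos y (Set.Ioo_subset_Icc_self hy)))
    (fun k y hy ↦ ?_) hxmem (summable_rpowExpPrimitiveTerm a b c hx) hxmem
  · rwa [tsum_mul_left, ← congrFun NormedSpace.exp_eq_tsum_div (c * x), ← Real.exp_eq_exp_ℝ] at key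
  · have hy' := Set.Ioo_subset_Icc_self hy
    have hy0 := hpos y hy'
    have hM0 := (norm_nonneg _).trans (hM y hy')
    rw [norm_mul, norm_div, norm_pow, norm_mul c, Real.norm_natCast, Real.norm_eq_abs c,
      Real.norm_of_nonneg hy0.le]
    gcongr
    · exact hM y hy'
    · exact hy'.2

open Real in
/-- Type II: the function Q = G⁻¹_{α,β,α'} (series plus possible log term, encoded by
replacing the term at k = α/β, if any, by the log term) converges for x > 0 and is
differentiable with Q'(x) = (1/β)x^{−α/β−1}exp(−α'x/β) ≠ 0, hence Q is strictly
monotone and injective on (0,∞). -/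
theorem stmt_13 (α β γ α' β' γ' : ℝ) (hβ : β ≠ 0) (hβ' : β' = 0)
    (Q : ℝ → ℝ)
    (hQ : ∀ x : ℝ, Q x = ∑' k : ℕ,
      (if (k : ℝ) = α / β
        then ((-α' / β) ^ k / ((k.factorial : ℝ) * β)) * Real.log x
        else ((-α' / β) ^ k / ((k.factorial : ℝ) * β)) * x ^ ((k : ℝ) - α / β)
              / ((k : ℝ) - α / β))) :
    (∀ x : ℝ, 0 < x →
      (Summable fun k : ℕ =>
        (if (k : ℝ) = α / β
          then ((-α' / β) ^ k / ((k.factorial : ℝ) * β)) * Real.log x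
          else ((-α' / β) ^ k / ((k.factorial : ℝ) * β)) * x ^ ((k : ℝ) - α / β)
                / ((k : ℝ) - α / β))) ∧
      HasDerivAt Q ((1 / β) * x ^ (-(α / β) - 1) * Real.exp (-α' * x / β)) x ∧
      (1 / β) * x ^ (-(α / β) - 1) * Real.exp (-α' * x / β) ≠ 0) ∧
    (StrictMonoOn Q (Set.Ioi 0) ∨ StrictAntiOn Q (Set.Ioi 0)) ∧
    Set.InjOn Q (Set.Ioi 0) := by

  have hterm : ∀ (k : ℕ) (x : ℝ), (if (k : ℝ) = α / β
        then ((-α' / β) ^ k / ((k.factorial : ℝ) * β)) * Real.log x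
        else ((-α' / β) ^ k / ((k.factorial : ℝ) * β)) * x ^ ((k : ℝ) - α / β)
              / ((k : ℝ) - α / β)) = rpowExpPrimitiveTerm (α / β) β (-α' / β) k x :=
    fun _ _ ↦ rfl
  simp only [hterm] at hQ ⊢
  obtain rfl : Q = _ := funext hQ
  have hderiv : ∀ x : ℝ, 0 < x → HasDerivAt
      (fun x ↦ ∑' k, rpowExpPrimitiveTerm (α / β) β (-α' / β) k x)
      (1 / β * x ^ (-(α / β) - 1) * Real.exp (-α' * x / β)) x := fun x hx ↦ by
    rw [mul_div_right_comm]
    exact hasDerivAt_tsum_rpowExpPrimitiveTerm _ _ _ hx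
  have hcont : ContinuousOn (fun x ↦ ∑' k, rpowExpPrimitiveTerm (α / β) β (-α' / β) k x)
      (Set.Ioi 0) := fun x hx ↦ (hderiv x hx).continuousAt.continuousWithinAt
  have hfac : ∀ x : ℝ, 0 < x → 0 < x ^ (-(α / β) - 1) := fun x hx ↦ Real.rpow_pos_of_pos hx _
  have hmono : StrictMonoOn (fun x ↦ ∑' k, rpowExpPrimitiveTerm (α / β) β (-α' / β) k x)
      (Set.Ioi 0) ∨ StrictAntiOn (fun x ↦ ∑' k, rpowExpPrimitiveTerm (α / β) β (-α' / β) k x)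
      (Set.Ioi 0) := by
    rcases hβ.lt_or_gt with h | h
    · refine Or.inr (strictAntiOn_of_deriv_neg (convex_Ioi 0) hcont fun x hx ↦ ?_)
      rw [interior_Ioi] at hx
      rw [(hderiv x hx).deriv]
      exact mul_neg_of_neg_of_pos (mul_neg_of_neg_of_pos (one_div_neg.mpr h) (hfac x hx))
        (Real.exp_pos _)
    · refine Or.inl (strictMonoOn_of_deriv_pos (convex_Ioi 0) hcont fun x hx ↦ ?_)
      rw [interior_Ioi] at hx
      rw [(hderiv x hx).deriv]
      exact mul_pos (mul_pos (one_div_pos.mpr h) (hfac x hx)) (Real.exp_pos _)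
  refine ⟨fun x hx ↦ ⟨summable_rpowExpPrimitiveTerm _ _ _ hx, hderiv x hx,
    mul_ne_zero (mul_ne_zero (one_div_ne_zero hβ) (hfac x hx).ne') (Real.exp_ne_zero _)⟩,
    hmono, hmono.elim StrictMonoOn.injOn StrictAntiOn.injOn⟩
end

section
/- Let σ ∈ {−1,+1} and r, r' ∈ ℝ. Then for every X with 0 < X < 1 the series defining Q converges, and Q is differentiable at X with derivative Q'(X) = X^{−r−1}·(1+σ·X)^{r−r'−1} (HasDerivAt, with both factors real powers of positive bases). In particular Q'(X) > 0 for all 0 < X < 1, so Q is strictly monotone and injective on (0,1). -/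
open Finset in
/-- `Ring.choose` over `ℝ` as a product divided by a factorial. -/
theorem Real.ringChoose_eq_prod_div (a : ℝ) (k : ℕ) :
    Ring.choose a k = (∏ i ∈ range k, (a - (i : ℝ))) / (k.factorial : ℝ) := by
  rw [Ring.choose_eq_smul, ← Polynomial.aeval_eq_smeval, ← Polynomial.eval_map_algebraMap,
    descPochhammer_map, descPochhammer_eval_eq_prod_range, smul_eq_mul, inv_mul_eq_div]

/-- The binomial series converges absolutely on `(-1, 1)`. -/
theorem Real.summable_abs_ringChoose_mul_pow (a : ℝ) {x : ℝ} (hx : |x| < 1) :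
    Summable fun k : ℕ => |Ring.choose a k * x ^ k| := by
  have hmem : x ∈ Metric.eball (0 : ℝ) (binomialSeries ℝ a).radius := by
    refine Metric.eball_subset_eball binomialSeries_radius_ge_one ?_
    rw [← ENNReal.ofReal_one, Metric.eball_ofReal]
    simpa using hx
  simpa [binomialSeries, abs_mul, mul_comm] using (binomialSeries ℝ a).summable_norm_apply hmem

/-- The binomial series sums to `(1 + x) ^ a` on `(-1, 1)`. -/
theorem Real.hasSum_ringChoose_mul_pow (a : ℝ) {x : ℝ} (hx : |x| < 1) :
    HasSum (fun k : ℕ => Ring.choose a k * x ^ k) ((1 + x) ^ a) := by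
  have hmem : x ∈ Metric.eball (0 : ℝ) 1 := by
    rw [← ENNReal.ofReal_one, Metric.eball_ofReal]
    simpa using hx
  simpa [binomialSeries, mul_comm] using (Real.one_add_rpow_hasFPowerSeriesOnBall_zero (a := a)).hasSum hmem

/-- The antiderivative on `(0, ∞)` of `x ↦ c * (x ^ k * x ^ (-r - 1))`. -/
noncomputable def monomialPrimitive (r c : ℝ) (k : ℕ) (x : ℝ) : ℝ :=
  if (k : ℝ) = r then c * Real.log x else c * x ^ ((k : ℝ) - r) / ((k : ℝ) - r)

theorem hasDerivAt_monomialPrimitive (r c : ℝ) (k : ℕ) {x : ℝ} (hx : 0 < x) :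
    HasDerivAt (monomialPrimitive r c k) (c * (x ^ k * x ^ (-r - 1))) x := by
  have hpow : x ^ k * x ^ (-r - 1) = x ^ ((k : ℝ) - r - 1) := by
    rw [← Real.rpow_natCast, ← Real.rpow_add hx]
    ring_nf
  rw [hpow]
  unfold monomialPrimitive
  split_ifs with h
  · refine ((Real.hasDerivAt_log hx.ne').const_mul c).congr_deriv ?_
    rw [h, sub_self, zero_sub, Real.rpow_neg_one]
  · have hne : (k : ℝ) - r ≠ 0 := sub_ne_zero.mpr h
    refine (((Real.hasDerivAt_rpow_const (p := (k : ℝ) - r) (Or.inl hx.ne')).const_mul c).div_const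
      ((k : ℝ) - r)).congr_deriv ?_
    field_simp

theorem summable_monomialPrimitive (r : ℝ) {c : ℕ → ℝ} {x : ℝ} (hx : 0 < x)
    (hc : Summable fun k => |c k| * x ^ k) :
    Summable fun k => monomialPrimitive r (c k) k x := by
  refine Summable.of_norm_bounded_eventually_nat (hc.mul_right (x ^ (-r))) ?_
  filter_upwards [Filter.eventually_ge_atTop (⌈r + 1⌉₊)] with k hk
  have hk' : r + 1 ≤ k := Nat.ceil_le.mp hk
  have hne : (k : ℝ) ≠ r := by linarith
  rw [monomialPrimitive, if_neg hne, Real.norm_eq_abs, abs_div, abs_mul,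
    abs_of_pos (Real.rpow_pos_of_pos hx _), abs_of_pos (by linarith : 0 < (k : ℝ) - r), mul_assoc,
    ← Real.rpow_natCast x k, ← Real.rpow_add hx, ← sub_eq_add_neg]
  exact div_le_self (mul_nonneg (abs_nonneg _) (Real.rpow_pos_of_pos hx _).le) (by linarith)

theorem Real.rpow_le_rpow_add_one {a x : ℝ} (p : ℝ) (ha : 0 < a) (hax : a ≤ x) (hx : x ≤ 1) :
    x ^ p ≤ a ^ p + 1 := by
  have hapos := Real.rpow_pos_of_pos ha p
  rcases le_total 0 p with hp | hp
  · linarith [Real.rpow_le_one (ha.le.trans hax) hx hp]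
  · linarith [Real.rpow_le_rpow_of_nonpos ha hax hp]

/-- Termwise differentiation of a power series multiplied by `x ^ (-r - 1)`. -/
theorem hasDerivAt_tsum_monomialPrimitive (r : ℝ) {c : ℕ → ℝ}
    (hc : ∀ x : ℝ, 0 < x → x < 1 → Summable fun k => |c k| * x ^ k) {x : ℝ}
    (hx : 0 < x) (hx1 : x < 1) :
    HasDerivAt (fun y => ∑' k, monomialPrimitive r (c k) k y)
      (∑' k, c k * (x ^ k * x ^ (-r - 1))) x := by
  obtain ⟨b, hxb, hb1⟩ := exists_between hx1
  obtain ⟨a, ha0, hax⟩ := exists_between hx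
  have hxmem : x ∈ Set.Ioo a b := ⟨hax, hxb⟩
  refine hasDerivAt_tsum_of_isPreconnected
    (u := fun k => |c k| * b ^ k * (a ^ (-r - 1) + 1)) (g := fun k => monomialPrimitive r (c k) k)
    (g' := fun k y => c k * (y ^ k * y ^ (-r - 1)))
    ((hc b (hx.trans hxb) hb1).mul_right _) isOpen_Ioo isPreconnected_Ioo
    (fun k y hy => hasDerivAt_monomialPrimitive r (c k) k (ha0.trans hy.1)) ?_ hxmem
    (summable_monomialPrimitive r hx (hc x hx hx1)) hxmem
  intro k y hy
  have hy0 : 0 < y := ha0.trans hy.1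
  rw [Real.norm_eq_abs, abs_mul, abs_of_pos (by positivity : 0 < y ^ k * y ^ (-r - 1)), mul_assoc]
  gcongr
  · exact pow_nonneg (hx.trans hxb).le k
  · exact hy.2.le
  · exact Real.rpow_le_rpow_add_one _ ha0 hy.1.le (hy.2.trans hb1).le


open Real in
/-- Type I: the function Q = G⁻¹_{r,r',σ} (series plus possible log term, encoded by
replacing the term at k = r, if any, by the log term; binom is the generalized binomial
coefficient) converges for 0 < X < 1 and is differentiable with
Q'(X) = X^{−r−1}(1+σX)^{r−r'−1} > 0, hence Q is strictly increasing and injective on (0,1). -/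
theorem stmt_14 (σ r r' : ℝ) (hσ : σ = 1 ∨ σ = -1)
    (binom : ℝ → ℕ → ℝ)
    (hbinom : ∀ (a : ℝ) (k : ℕ),
      binom a k = (∏ i ∈ Finset.range k, (a - (i : ℝ))) / (k.factorial : ℝ))
    (Q : ℝ → ℝ)
    (hQ : ∀ X : ℝ, Q X = ∑' k : ℕ,
      (if (k : ℝ) = r
        then σ ^ k * binom (r - r' - 1) k * Real.log X
        else σ ^ k * binom (r - r' - 1) k * X ^ ((k : ℝ) - r) / ((k : ℝ) - r))) :
    (∀ X : ℝ, 0 < X → X < 1 →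
      (Summable fun k : ℕ =>
        (if (k : ℝ) = r
          then σ ^ k * binom (r - r' - 1) k * Real.log X
          else σ ^ k * binom (r - r' - 1) k * X ^ ((k : ℝ) - r) / ((k : ℝ) - r))) ∧
      HasDerivAt Q (X ^ (-r - 1) * (1 + σ * X) ^ (r - r' - 1)) X ∧
      0 < X ^ (-r - 1) * (1 + σ * X) ^ (r - r' - 1)) ∧
    StrictMonoOn Q (Set.Ioo 0 1) ∧
    Set.InjOn Q (Set.Ioo 0 1) := by
  have hσabs : |σ| = 1 := by rcases hσ with rfl | rfl <;> simp
  set c : ℕ → ℝ := fun k => σ ^ k * binom (r - r' - 1) k with hcdef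
  have hchoose (k : ℕ) : binom (r - r' - 1) k = Ring.choose (r - r' - 1) k := by
    rw [hbinom, Real.ringChoose_eq_prod_div]
  have hlt {X : ℝ} (h0 : 0 < X) (h1 : X < 1) : |σ * X| < 1 := by
    rwa [abs_mul, hσabs, one_mul, abs_of_pos h0]
  have hc : ∀ X : ℝ, 0 < X → X < 1 → Summable fun k => |c k| * X ^ k := by
    intro X h0 h1
    convert Real.summable_abs_ringChoose_mul_pow (r - r' - 1) (hlt h0 h1) using 2 with k
    simp [hcdef, hchoose, abs_mul, mul_pow, hσabs, abs_of_pos h0]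
  have hsum {X : ℝ} (h0 : 0 < X) (h1 : X < 1) :
      ∑' k, c k * (X ^ k * X ^ (-r - 1)) = X ^ (-r - 1) * (1 + σ * X) ^ (r - r' - 1) := by
    rw [← (Real.hasSum_ringChoose_mul_pow (r - r' - 1) (hlt h0 h1)).tsum_eq, ← tsum_mul_left]
    refine tsum_congr fun k => ?_
    simp only [hcdef, hchoose, mul_pow]
    ring
  have hQ' : Q = fun X => ∑' k, monomialPrimitive r (c k) k X := funext hQ
  have hderiv {X : ℝ} (h0 : 0 < X) (h1 : X < 1) :
      HasDerivAt Q (X ^ (-r - 1) * (1 + σ * X) ^ (r - r' - 1)) X := by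
    rw [hQ', ← hsum h0 h1]
    exact hasDerivAt_tsum_monomialPrimitive r hc h0 h1
  have hpos {X : ℝ} (h0 : 0 < X) (h1 : X < 1) :
      0 < X ^ (-r - 1) * (1 + σ * X) ^ (r - r' - 1) := by
    have := (abs_lt.mp (hlt h0 h1)).1
    exact mul_pos (Real.rpow_pos_of_pos h0 _) (Real.rpow_pos_of_pos (by linarith) _)
  have hmono : StrictMonoOn Q (Set.Ioo 0 1) := by
    refine strictMonoOn_of_deriv_pos (convex_Ioo 0 1)
      (fun X hX => (hderiv hX.1 hX.2).continuousAt.continuousWithinAt) fun X hX => ?_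
    rw [interior_Ioo] at hX
    rw [(hderiv hX.1 hX.2).deriv]
    exact hpos hX.1 hX.2
  exact ⟨fun X h0 h1 => ⟨summable_monomialPrimitive r h0 (hc X h0 h1), hderiv h0 h1, hpos h0 h1⟩,
    hmono, hmono.injOn⟩
end

section
/- (Residue formula for Type II row polynomials.) Assume β ≠ 0 and β' = 0. Fix x > 0 and n ∈ ℕ, and define f : ℝ → ℝ by f(z) = z^{γ/β−1}·exp(γ'·z/β)·(z−x)^{n+1}/(Q(z)−Q(x))^{n+1} (real powers; with Lean's conventions Real.rpow and division-by-zero = 0 this defines f totally, and Q(z) is defined by the same series for z > 0). Then the n-th derivative of f has a limit as z → x within z ≠ x, namely: Filter.Tendsto (iteratedDeriv n f) (𝓝[≠] x) (𝓝 (β·x^{((n+1)·α+γ)/β}·exp(((n+1)·α'+γ')·x/β)·P_n(x))). -/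
section
open Topology Filter

/-- At the base point, differentiating `(z - x) * g z` one time more than `g` multiplies the
derivative of `g` by the order. -/
lemma iteratedDeriv_succ_sub_mul_self {g : ℝ → ℝ} {x : ℝ} (hg : AnalyticAt ℝ g x) (n : ℕ) :
    iteratedDeriv (n + 1) (fun z => (z - x) * g z) x = (n + 1) * iteratedDeriv n g x := by
  have hderiv {g : ℝ → ℝ} (hg : AnalyticAt ℝ g x) :
      deriv (fun z => (z - x) * g z) =ᶠ[𝓝 x] fun z => g z + (z - x) * deriv g z := by
    filter_upwards [hg.eventually_analyticAt] with z hz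
    simpa using (((hasDerivAt_id z).sub_const x).fun_mul hz.differentiableAt.hasDerivAt).deriv
  induction n generalizing g with
  | zero => simp [iteratedDeriv_one, (hderiv hg).eq_of_nhds]
  | succ n ih =>
    rw [iteratedDeriv_succ', (hderiv hg).iteratedDeriv_eq,
      iteratedDeriv_fun_add hg.contDiffAt
        (AnalyticAt.contDiffAt (by have := hg.deriv; fun_prop)),
      ih hg.deriv, ← iteratedDeriv_succ']
    push_cast
    ring

/-- **Lagrange inversion**, iterated: if `F (k + 1)` is the derivative of `F k` with respect to
`(z - x) * w z`, then `F (k + n)` at `x` is an `n`-th derivative at `x`. -/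
lemma iteratedDeriv_lagrange {q w : ℝ → ℝ} {x : ℝ} {F : ℕ → ℝ → ℝ}
    (hw : AnalyticAt ℝ w x) (hw0 : w x ≠ 0) (hF : ∀ k, AnalyticAt ℝ (F k) x)
    (hq : q =ᶠ[𝓝 x] fun z => w z + (z - x) * deriv w z)
    (hFd : ∀ k, deriv (F k) =ᶠ[𝓝 x] fun z => q z * F (k + 1) z) (n k : ℕ) :
    iteratedDeriv n (fun z => q z * F k z / w z ^ (n + 1)) x = F (k + n) x := by
  induction n generalizing k with
  | zero => simp [hq.eq_of_nhds, hw0]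
  | succ n ih =>
    set v : ℝ → ℝ := fun z => F k z / w z ^ (n + 1)
    set s : ℝ → ℝ := fun z => q z * F (k + 1) z / w z ^ (n + 1)
    have hv : AnalyticAt ℝ v x := (hF k).div (hw.pow _) (pow_ne_zero _ hw0)
    have hqa : AnalyticAt ℝ q x :=
      (hw.add ((analyticAt_id.sub analyticAt_const).mul hw.deriv)).congr hq.symm
    have hs : AnalyticAt ℝ s x := (hqa.mul (hF (k + 1))).div (hw.pow _) (pow_ne_zero _ hw0)
    have hn : (n + 1 : ℝ) ≠ 0 := by positivity
    have key : (fun z => q z * F k z / w z ^ (n + 1 + 1)) =ᶠ[𝓝 x]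
        fun z => v z + (n + 1 : ℝ)⁻¹ * ((z - x) * (s z - deriv v z)) := by
      filter_upwards [hq, hFd k, (hF k).eventually_analyticAt, hw.eventually_analyticAt,
        hw.continuousAt.eventually_ne hw0] with z hqz hFz hFa hwa hw0z
      have hvd : deriv v z = (deriv (F k) z * w z ^ (n + 1)
          - F k z * ((n + 1 : ℕ) * w z ^ n * deriv w z)) / (w z ^ (n + 1)) ^ 2 := by
        simpa using (hFa.differentiableAt.hasDerivAt.fun_div
          (hwa.differentiableAt.hasDerivAt.fun_pow (n + 1)) (pow_ne_zero _ hw0z)).deriv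
      rw [hvd, hFz]
      simp only [v, s, hqz]
      push_cast
      field_simp
      ring
    rw [key.iteratedDeriv_eq, iteratedDeriv_fun_add hv.contDiffAt
      (AnalyticAt.contDiffAt (by have := hv.deriv; fun_prop)), iteratedDeriv_const_mul_field,
      iteratedDeriv_succ_sub_mul_self (hs.fun_sub hv.deriv),
      iteratedDeriv_fun_sub hs.contDiffAt hv.deriv.contDiffAt, ← iteratedDeriv_succ', ih,
      inv_mul_cancel_left₀ hn]
    rw [show k + 1 + n = k + (n + 1) by ring]
    ring

/-- The quotient form of Lagrange inversion, where `Q` has derivative `q` and `F (k + 1)` is the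
derivative of `F k` with respect to `Q`. -/
lemma tendsto_iteratedDeriv_lagrange {Q q : ℝ → ℝ} {x : ℝ} {F : ℕ → ℝ → ℝ}
    (hQ : AnalyticAt ℝ Q x) (hQd : ∀ᶠ z in 𝓝 x, HasDerivAt Q (q z) z) (hq0 : q x ≠ 0)
    (hF : ∀ k, AnalyticAt ℝ (F k) x)
    (hFd : ∀ k, deriv (F k) =ᶠ[𝓝 x] fun z => q z * F (k + 1) z) (n : ℕ) {f : ℝ → ℝ}
    (hf : f =ᶠ[𝓝[≠] x] fun z => q z * F 0 z * (z - x) ^ (n + 1) / (Q z - Q x) ^ (n + 1)) :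
    Tendsto (iteratedDeriv n f) (𝓝[≠] x) (𝓝 (F n x)) := by
  set w := dslope Q x
  have hw : AnalyticAt ℝ w x := hQ.choose_spec.has_fpower_series_dslope_fslope.analyticAt
  have hsub (z : ℝ) : Q z - Q x = (z - x) * w z := (sub_smul_dslope Q x z).symm
  have hw0 : w x ≠ 0 := by rwa [show w x = q x by simp [w, hQd.self_of_nhds.deriv]]
  have hq : q =ᶠ[𝓝 x] fun z => w z + (z - x) * deriv w z := by
    filter_upwards [hQd, hw.eventually_analyticAt] with z hz hwz
    have h1 := (hz.sub_const (Q x)).deriv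
    have h2 := (((hasDerivAt_id z).sub_const x).fun_mul hwz.differentiableAt.hasDerivAt).deriv
    rw [← h1, show (fun z => Q z - Q x) = _ from funext hsub]
    simpa using h2
  set g : ℝ → ℝ := fun z => q z * F 0 z / w z ^ (n + 1)
  have hqa : AnalyticAt ℝ q x :=
    (hw.add ((analyticAt_id.sub analyticAt_const).mul hw.deriv)).congr hq.symm
  have hg : AnalyticAt ℝ g x := (hqa.mul (hF 0)).div (hw.pow _) (pow_ne_zero _ hw0)
  have hfg : f =ᶠ[𝓝[≠] x] g := by
    filter_upwards [hf, self_mem_nhdsWithin] with z hz hzx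
    have : z - x ≠ 0 := sub_ne_zero.mpr hzx
    rw [hz, hsub, mul_pow, mul_comm ((z - x) ^ (n + 1)), mul_div_mul_right _ _ (by positivity)]
  have hlim : Tendsto (iteratedDeriv n g) (𝓝 x) (𝓝 (F n x)) := by
    have h := iteratedDeriv_lagrange hw hw0 hF hq hFd n 0
    rw [zero_add] at h
    rw [← h, iteratedDeriv_eq_iterate]
    exact (hg.iterated_deriv n).continuousAt
  refine (hlim.mono_left nhdsWithin_le_nhds).congr' ?_
  filter_upwards [eventually_eventually_nhdsWithin.mpr hfg, self_mem_nhdsWithin] with z hz hzx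
  rw [isOpen_compl_singleton.nhdsWithin_eq hzx] at hz
  exact (EventuallyEq.iteratedDeriv_eq n hz).symm

/-- A real antiderivative of the restriction of a holomorphic function is analytic. -/
lemma analyticAt_of_hasDerivAt_re {F : ℝ → ℝ} {f : ℂ → ℂ} {x r : ℝ} (hr : 0 < r)
    (hf : DifferentiableOn ℂ f (Metric.ball (x : ℂ) r))
    (hF : ∀ z ∈ Metric.ball x r, HasDerivAt F (f z).re z) : AnalyticAt ℝ F x := by
  obtain ⟨G, hG⟩ := hf.isExactOn_ball
  have hGa : AnalyticAt ℂ G x := DifferentiableOn.analyticAt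
    (fun z hz => (hG z hz).differentiableAt.differentiableWithinAt) (Metric.ball_mem_nhds _ hr)
  have hGd (z : ℝ) (hz : z ∈ Metric.ball x r) : HasDerivAt (fun t : ℝ => (G t).re) (f z).re z :=
    (hG z (by simpa [Complex.dist_eq, ← Complex.ofReal_sub, Real.dist_eq] using hz)).real_of_complex
  obtain ⟨c, hc⟩ := Metric.isOpen_ball.exists_is_const_of_deriv_eq_zero
    (f := fun z => F z - (G z).re) (convex_ball x r).isPreconnected
    (fun z hz => ((hF z hz).sub (hGd z hz)).differentiableAt.differentiableWithinAt)
    (fun z hz => by simpa using ((hF z hz).fun_sub (hGd z hz)).deriv)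
  refine (hGa.re_ofReal.add (analyticAt_const (v := c))).congr ?_
  filter_upwards [Metric.ball_mem_nhds x hr] with z hz
  simp [← hc z hz]

/-- The termwise derivative of the series that defines the inverse of `G`. -/
lemma hasDerivAt_tsum_rpow_or_log (a b β : ℝ) {x : ℝ} (hx : 0 < x) :
    HasDerivAt (fun z : ℝ => ∑' k : ℕ,
      (if (k : ℝ) = a
        then (b ^ k / ((k.factorial : ℝ) * β)) * Real.log z
        else (b ^ k / ((k.factorial : ℝ) * β)) * z ^ ((k : ℝ) - a) / ((k : ℝ) - a)))
      (x ^ (-a - 1) * Real.exp (b * x) / β) x := by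
  have hexp (y : ℝ) : HasSum (fun k : ℕ => y ^ k / (k.factorial : ℝ)) (Real.exp y) := by
    rw [Real.exp_eq_exp_ℝ]
    exact NormedSpace.expSeries_div_hasSum_exp y
  have hpow {z : ℝ} (hz : 0 < z) (k : ℕ) (s : ℝ) : z ^ ((k : ℝ) + s) = z ^ k * z ^ s := by
    rw [Real.rpow_add hz, Real.rpow_natCast]
  have hterm (z : ℝ) (hz : 0 < z) (k : ℕ) :
      b ^ k / ((k.factorial : ℝ) * β) * z ^ ((k : ℝ) - a - 1)
        = (b * z) ^ k / k.factorial * (z ^ (-a - 1) / β) := by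
    rw [show (k : ℝ) - a - 1 = k + (-a - 1) by ring, hpow hz, mul_pow, div_mul_eq_div_div]
    ring
  obtain ⟨M, hM⟩ := isCompact_Icc.exists_bound_of_continuousOn
    (s := Set.Icc (x / 2) (2 * x)) (f := fun z : ℝ => z ^ (-a - 1) / β)
    (fun z hz => ((Real.continuousAt_rpow_const _ _
      (Or.inl (by linarith [hz.1] : (0 : ℝ) < z).ne')).div_const β).continuousWithinAt)
  have hmem : x ∈ Set.Ioo (x / 2) (2 * x) := ⟨by linarith, by linarith⟩
  have hu : Summable fun k : ℕ => (|b| * (2 * x)) ^ k / (k.factorial : ℝ) * M :=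
    (hexp _).summable.mul_right M
  have hsum : Summable fun k : ℕ => (if (k : ℝ) = a
        then (b ^ k / ((k.factorial : ℝ) * β)) * Real.log x
        else (b ^ k / ((k.factorial : ℝ) * β)) * x ^ ((k : ℝ) - a) / ((k : ℝ) - a)) := by
    refine Summable.of_norm_bounded_eventually_nat
      (((hexp (b * x)).summable.norm).mul_right |x ^ (-a) / β|) ?_
    obtain ⟨N, hN⟩ := exists_nat_ge (a + 1)
    filter_upwards [eventually_ge_atTop N] with k hk
    have hk1 : 1 ≤ (k : ℝ) - a := by
      have : (N : ℝ) ≤ k := by exact_mod_cast hk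
      linarith
    rw [if_neg (by linarith), sub_eq_add_neg (k : ℝ) a, hpow hx, ← sub_eq_add_neg, norm_div,
      Real.norm_of_nonneg (by linarith : 0 ≤ (k : ℝ) - a)]
    refine (div_le_self (norm_nonneg _) hk1).trans_eq ?_
    rw [← Real.norm_eq_abs, ← norm_mul, mul_pow, div_mul_eq_div_div]
    congr 1
    ring
  have h := hasDerivAt_tsum_of_isPreconnected hu isOpen_Ioo isPreconnected_Ioo
    (g := fun (k : ℕ) (z : ℝ) => (if (k : ℝ) = a
        then (b ^ k / ((k.factorial : ℝ) * β)) * Real.log z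
        else (b ^ k / ((k.factorial : ℝ) * β)) * z ^ ((k : ℝ) - a) / ((k : ℝ) - a)))
    (g' := fun k z => b ^ k / ((k.factorial : ℝ) * β) * z ^ ((k : ℝ) - a - 1))
    (fun k z hz => ?_) (fun k z hz => ?_) hmem hsum hmem
  · refine h.congr_deriv ?_
    simp only [hterm x hx]
    rw [((hexp (b * x)).mul_right _).tsum_eq]
    ring
  · have hz0 : 0 < z := by linarith [hz.1]
    split_ifs with hka
    · refine ((Real.hasDerivAt_log hz0.ne').const_mul _).congr_deriv ?_
      rw [hka, sub_self, zero_sub, Real.rpow_neg_one]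
    · have hne : (k : ℝ) - a ≠ 0 := sub_ne_zero.mpr hka
      refine (((Real.hasDerivAt_rpow_const (p := (k : ℝ) - a) (Or.inl hz0.ne')).const_mul
        (b ^ k / ((k.factorial : ℝ) * β))).div_const ((k : ℝ) - a)).congr_deriv ?_
      field_simp
  · have hz0 : 0 < z := by linarith [hz.1]
    rw [hterm z hz0, norm_mul, norm_div, norm_pow, norm_mul, Real.norm_natCast, Real.norm_eq_abs,
      Real.norm_of_nonneg hz0.le]
    have := hM z (Set.Ioo_subset_Icc_self hz)
    have := hz.2.le
    gcongr

/-- A real function with derivative `z ^ s * exp (b * z) / β` on the positive half-line is analytic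
there. -/
lemma analyticAt_of_hasDerivAt_rpow_mul_exp {F : ℝ → ℝ} {s b β x : ℝ} (hx : 0 < x)
    (hF : ∀ z, 0 < z → HasDerivAt F (z ^ s * Real.exp (b * z) / β) z) : AnalyticAt ℝ F x := by
  refine analyticAt_of_hasDerivAt_re (f := fun z => z ^ (s : ℂ) * Complex.exp (b * z) / β) hx ?_ ?_
  · intro z hz
    have hre : 0 < z.re := by
      have h := (Complex.abs_re_le_norm (z - x)).trans_lt (mem_ball_iff_norm.mp hz)
      rw [Complex.sub_re, Complex.ofReal_re] at h
      linarith [(abs_lt.mp h).1]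
    have hz' : z ∈ Complex.slitPlane := Or.inl hre
    exact (((differentiableAt_id.cpow_const hz').mul (by fun_prop)).div_const _
      ).differentiableWithinAt
  · intro z hz
    have hz0 : 0 < z := by
      rw [Metric.mem_ball, Real.dist_eq] at hz
      linarith [(abs_lt.mp hz).1]
    have hcast : (z : ℂ) ^ (s : ℂ) * Complex.exp (b * z) / β
        = ((z ^ s * Real.exp (b * z) / β : ℝ) : ℂ) := by
      push_cast [Complex.ofReal_cpow hz0.le]
      rfl
    rw [hcast, Complex.ofReal_re]
    exact hF z hz0

/-- The entries of an array with a two-term recurrence vanish above the diagonal. -/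
lemma eq_zero_of_triangular_recurrence_s15 {A c d : ℕ → ℕ → ℝ} (h0k : ∀ k : ℕ, A 0 (k + 1) = 0)
    (hnk : ∀ n k : ℕ, A (n + 1) (k + 1) = c n k * A n (k + 1) + d n k * A n k) {n k : ℕ}
    (h : n < k) : A n k = 0 := by
  induction n generalizing k with
  | zero => obtain ⟨k, rfl⟩ := Nat.exists_eq_succ_of_ne_zero h.ne'; exact h0k k
  | succ n ih =>
    obtain ⟨k, rfl⟩ := Nat.exists_eq_succ_of_ne_zero (Nat.ne_zero_of_lt h)
    rw [Nat.succ_eq_add_one, hnk, ih (by omega), ih (by omega)]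
    simp

/-- The differential recurrence of the row polynomials of a GKP array with `β' = 0`. -/
lemma sum_gkp_row_succ {α β γ α' γ' : ℝ} {A : ℕ → ℕ → ℝ} (h0k : ∀ k : ℕ, A 0 (k + 1) = 0)
    (hn0 : ∀ n : ℕ, A (n + 1) 0 = (α * (n + 1) + γ) * A n 0)
    (hnk : ∀ n k : ℕ, A (n + 1) (k + 1) =
      (α * (n + 1) + β * (k + 1) + γ) * A n (k + 1) + (α' * (n + 1) + γ') * A n k)
    (n : ℕ) (z : ℝ) :
    ∑ k ∈ Finset.range (n + 1 + 1), A (n + 1) k * z ^ k =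
      ((n + 1) * α + γ + ((n + 1) * α' + γ') * z) * ∑ k ∈ Finset.range (n + 1), A n k * z ^ k
        + β * z * ∑ k ∈ Finset.range (n + 1), A n k * (k * z ^ (k - 1)) := by
  have hvan : A n (n + 1) = 0 := eq_zero_of_triangular_recurrence_s15 h0k hnk n.lt_succ_self
  have hdiag : ∑ k ∈ Finset.range (n + 1), (α * (n + 1) + β * k + γ) * A n k * z ^ k
      = ∑ k ∈ Finset.range (n + 1), (α * (n + 1) + β * (k + 1) + γ) * A n (k + 1) * z ^ (k + 1)
        + (α * (n + 1) + γ) * A n 0 := by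
    have h := Finset.sum_range_succ' (fun k : ℕ => (α * (n + 1) + β * k + γ) * A n k * z ^ k) (n + 1)
    rw [Finset.sum_range_succ, hvan] at h
    simpa using h
  have hder : z * ∑ k ∈ Finset.range (n + 1), A n k * (k * z ^ (k - 1))
      = ∑ k ∈ Finset.range (n + 1), k * A n k * z ^ k := by
    rw [Finset.mul_sum]
    refine Finset.sum_congr rfl fun k _ => ?_
    cases k with
    | zero => simp
    | succ k => rw [Nat.add_sub_cancel]; ring
  rw [Finset.sum_range_succ', mul_assoc β, hder, hn0, pow_zero, mul_one]
  simp_rw [hnk, add_mul (_ * A n _), Finset.sum_add_distrib]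
  rw [add_right_comm, ← hdiag]
  simp_rw [Finset.mul_sum, ← Finset.sum_add_distrib]
  refine Finset.sum_congr rfl fun k _ => ?_
  ring

end

open Real Topology in
/-- Residue formula for Type II row polynomials: with Q = G⁻¹_{α,β,α'} and
f(z) = z^{γ/β−1}exp(γ'z/β)(z−x)^{n+1}/(Q(z)−Q(x))^{n+1}, the n-th derivative of f
tends to β·x^{((n+1)α+γ)/β}·exp(((n+1)α'+γ')x/β)·P_n(x) as z → x, z ≠ x. -/
theorem stmt_15 (α β γ α' β' γ' : ℝ) (hβ : β ≠ 0) (hβ' : β' = 0) (A : ℕ → ℕ → ℝ)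
    (h00 : A 0 0 = 1)
    (h0k : ∀ k : ℕ, A 0 (k + 1) = 0)
    (hn0 : ∀ n : ℕ, A (n + 1) 0 = (α * (n + 1) + γ) * A n 0)
    (hnk : ∀ n k : ℕ, A (n + 1) (k + 1) =
      (α * (n + 1) + β * (k + 1) + γ) * A n (k + 1)
        + (α' * (n + 1) + β' * (k + 1) + γ') * A n k)
    (Q : ℝ → ℝ)
    (hQ : ∀ x : ℝ, Q x = ∑' k : ℕ,
      (if (k : ℝ) = α / β
        then ((-α' / β) ^ k / ((k.factorial : ℝ) * β)) * Real.log x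
        else ((-α' / β) ^ k / ((k.factorial : ℝ) * β)) * x ^ ((k : ℝ) - α / β)
              / ((k : ℝ) - α / β)))
    (x : ℝ) (hx : 0 < x) (n : ℕ) (f : ℝ → ℝ)
    (hf : ∀ z : ℝ, f z = z ^ (γ / β - 1) * Real.exp (γ' * z / β) * (z - x) ^ (n + 1)
        / (Q z - Q x) ^ (n + 1)) :
    Filter.Tendsto (iteratedDeriv n f) (𝓝[≠] x)
      (𝓝 (β * x ^ ((((n : ℝ) + 1) * α + γ) / β)
            * Real.exp (((((n : ℝ) + 1) * α' + γ') * x) / β)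
            * ∑ k ∈ Finset.range (n + 1), A n k * x ^ k)) := by
  subst hβ'
  simp only [zero_mul, add_zero] at hnk
  set F : ℕ → ℝ → ℝ := fun m z => β * z ^ ((((m : ℝ) + 1) * α + γ) / β)
    * Real.exp (((((m : ℝ) + 1) * α' + γ') * z) / β)
    * ∑ k ∈ Finset.range (m + 1), A m k * z ^ k with hFdef
  set q : ℝ → ℝ := fun z => z ^ (-(α / β) - 1) * Real.exp (-α' / β * z) / β with hqdef
  have hQd (z : ℝ) (hz : 0 < z) : HasDerivAt Q (q z) z := by
    rw [funext hQ]
    exact hasDerivAt_tsum_rpow_or_log (α / β) (-α' / β) β hz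
  have hQa : AnalyticAt ℝ Q x := analyticAt_of_hasDerivAt_rpow_mul_exp hx hQd
  have hpos : ∀ᶠ z in 𝓝 x, 0 < z := eventually_gt_nhds hx
  have hFa (m : ℕ) : AnalyticAt ℝ (F m) x := by
    have hr : AnalyticAt ℝ (fun z : ℝ => z ^ ((((m : ℝ) + 1) * α + γ) / β)) x :=
      (Real.contDiffAt_rpow_const_of_ne (n := ⊤) hx.ne').analyticAt
    have he : AnalyticAt ℝ (fun z : ℝ => Real.exp (((((m : ℝ) + 1) * α' + γ') * z) / β)) x :=
      AnalyticAt.rexp' (by fun_prop)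
    have hs : AnalyticAt ℝ (fun z : ℝ => ∑ k ∈ Finset.range (m + 1), A m k * z ^ k) x :=
      Finset.analyticAt_fun_sum _ fun k _ => by fun_prop
    exact ((analyticAt_const.mul hr).mul he).mul hs
  have hFd (m : ℕ) : deriv (F m) =ᶠ[𝓝 x] fun z => q z * F (m + 1) z := by
    filter_upwards [hpos] with z hz
    have hr : HasDerivAt (fun z : ℝ => z ^ ((((m : ℝ) + 1) * α + γ) / β)) _ z :=
      Real.hasDerivAt_rpow_const (Or.inl hz.ne')
    have he : HasDerivAt (fun z : ℝ => Real.exp (((((m : ℝ) + 1) * α' + γ') * z) / β)) _ z :=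
      (((hasDerivAt_id' z).const_mul _).div_const β).exp
    have hs : HasDerivAt (fun z : ℝ => ∑ k ∈ Finset.range (m + 1), A m k * z ^ k) _ z :=
      HasDerivAt.fun_sum fun k _ => (hasDerivAt_pow k z).const_mul (A m k)
    rw [(((hr.const_mul β).fun_mul he).fun_mul hs).deriv]
    have hpow : z ^ (((((m + 1 : ℕ) : ℝ) + 1) * α + γ) / β)
        * z ^ (-(α / β) - 1) = z ^ ((((m : ℝ) + 1) * α + γ) / β) / z := by
      rw [← Real.rpow_add hz, ← Real.rpow_sub_one hz.ne']
      congr 1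
      push_cast
      ring
    have hexp : Real.exp (((((m + 1 : ℕ) : ℝ) + 1) * α' + γ') * z / β)
        * Real.exp (-α' / β * z) = Real.exp ((((m : ℝ) + 1) * α' + γ') * z / β) := by
      rw [← Real.exp_add]
      congr 1
      push_cast
      ring
    have hqF : q z * F (m + 1) z = z ^ ((((m : ℝ) + 1) * α + γ) / β) / z
        * Real.exp ((((m : ℝ) + 1) * α' + γ') * z / β)
        * ∑ k ∈ Finset.range (m + 1 + 1), A (m + 1) k * z ^ k := by
      rw [← hpow, ← hexp]
      simp only [hFdef, hqdef]
      field_simp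
    rw [hqF, sum_gkp_row_succ h0k hn0 hnk, Real.rpow_sub_one hz.ne']
    field_simp
  refine tendsto_iteratedDeriv_lagrange (q := q) (F := F) hQa (hpos.mono hQd) ?_ hFa hFd n ?_
  · have := Real.rpow_pos_of_pos hx (-(α / β) - 1)
    simp only [hqdef]
    positivity
  · filter_upwards [nhdsWithin_le_nhds hpos] with z hz
    have hpow : z ^ (γ / β - 1) = z ^ (-(α / β) - 1) * z ^ (((((0 : ℕ) : ℝ) + 1) * α + γ) / β) := by
      rw [← Real.rpow_add hz]
      congr 1
      push_cast
      ring
    have hexp : Real.exp (γ' * z / β) = Real.exp (-α' / β * z)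
        * Real.exp (((((0 : ℕ) : ℝ) + 1) * α' + γ') * z / β) := by
      rw [← Real.exp_add]
      congr 1
      push_cast
      ring
    rw [hf, hpow, hexp]
    simp only [hFdef, hqdef, zero_add, Finset.sum_range_one, h00, pow_zero, mul_one]
    congr 2
    field_simp
end

section
/- (Type II exponential generating function solves the PDE.) Assume β ≠ 0 and β' = 0. Let V ⊆ ℝ be open and let g : ℝ → ℝ be differentiable on V with g(t) > 0 and Q(g(t)) = t for all t ∈ V (so g is a local inverse of Q). Let W be an open subset of (0,∞) × ℝ such that ξ(u,v) := v·u^{−α/β}·exp(−α'·u/β) + Q(u) ∈ V for all (u,v) ∈ W (real powers), and define F on W by F(u,v) := (g(ξ(u,v))/u)^{(α+γ)/β} · exp(−((α'+γ')/β)·(u − g(ξ(u,v)))). Then: (i) at every (u,v) ∈ W, the partial derivatives F_u and F_v exist and −β·u·F_u(u,v) + (1−(α+α'·u)·v)·F_v(u,v) = (α+γ+(α'+γ')·u)·F(u,v); (ii) F(u,0) = 1 whenever (u,0) ∈ W. -/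
/-- The `k`-th term of the series defining the antiderivative of
`b⁻¹ * x ^ (-a - 1) * exp (c * x)`; it is logarithmic when the exponent `k - a` vanishes. -/
noncomputable def expRpowTerm (a b c : ℝ) (k : ℕ) (x : ℝ) : ℝ :=
  if (k : ℝ) = a then (c ^ k / ((k.factorial : ℝ) * b)) * Real.log x
  else (c ^ k / ((k.factorial : ℝ) * b)) * x ^ ((k : ℝ) - a) / ((k : ℝ) - a)

lemma hasDerivAt_expRpowTerm (a b c : ℝ) (k : ℕ) {x : ℝ} (hx : 0 < x) :
    HasDerivAt (expRpowTerm a b c k)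
      ((c * x) ^ k / (k.factorial : ℝ) * (b⁻¹ * x ^ (-a - 1))) x := by
  unfold expRpowTerm
  split_ifs with hk
  · convert! (Real.hasDerivAt_log hx.ne').const_mul (c ^ k / ((k.factorial : ℝ) * b)) using 1
    rw [← hk, show -(k : ℝ) - 1 = -((k + 1 : ℕ) : ℝ) by push_cast; ring,
      Real.rpow_neg hx.le, Real.rpow_natCast, mul_pow, pow_succ]
    field_simp
  · have hk' : (k : ℝ) - a ≠ 0 := sub_ne_zero.mpr hk
    convert! ((Real.hasDerivAt_rpow_const (p := (k : ℝ) - a) (Or.inl hx.ne')).const_mul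
      (c ^ k / ((k.factorial : ℝ) * b))).div_const ((k : ℝ) - a) using 1
    rw [show (k : ℝ) - a - 1 = k + (-a - 1) by ring, Real.rpow_add hx, Real.rpow_natCast, mul_pow]
    field_simp

lemma summable_expRpowTerm (a b c : ℝ) {x : ℝ} (hx : 0 < x) :
    Summable fun k => expRpowTerm a b c k x := by
  refine Summable.of_norm_bounded_eventually_nat
    (((Real.summable_pow_div_factorial (|c| * x)).mul_right (|b|⁻¹ * x ^ (-a)))) ?_
  obtain ⟨N, hN⟩ := exists_nat_ge (a + 1)
  filter_upwards [Filter.eventually_ge_atTop N] with k hkN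
  have hk : 1 ≤ (k : ℝ) - a := by
    have : (N : ℝ) ≤ k := by exact_mod_cast hkN
    linarith
  have hne : (k : ℝ) ≠ a := by intro h; linarith
  rw [expRpowTerm, if_neg hne, Real.norm_eq_abs, abs_div, abs_of_pos (by linarith : 0 < (k : ℝ) - a)]
  refine (div_le_self (abs_nonneg _) hk).trans (le_of_eq ?_)
  rw [abs_mul, abs_div, abs_mul, abs_pow, Nat.abs_cast, abs_of_pos (Real.rpow_pos_of_pos hx _),
    sub_eq_add_neg, Real.rpow_add hx, Real.rpow_natCast, mul_pow]
  simp only [div_eq_mul_inv, mul_inv]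
  ring

lemma hasDerivAt_tsum_expRpowTerm (a b c : ℝ) {x : ℝ} (hx : 0 < x) :
    HasDerivAt (fun y => ∑' k, expRpowTerm a b c k y)
      (b⁻¹ * x ^ (-a - 1) * Real.exp (c * x)) x := by
  have hcont : ContinuousOn (fun y : ℝ => b⁻¹ * y ^ (-a - 1)) (Set.Icc (x / 2) (2 * x)) := by
    refine continuousOn_const.mul (continuousOn_id.rpow_const fun y hy => Or.inl ?_)
    have := hy.1
    simp only [id]
    linarith
  obtain ⟨M, hM⟩ := isCompact_Icc.exists_bound_of_continuousOn hcont
  have hmem : x ∈ Set.Ioo (x / 2) (2 * x) := ⟨by linarith, by linarith⟩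
  have h := hasDerivAt_tsum_of_isPreconnected
    ((Real.summable_pow_div_factorial (|c| * (2 * x))).mul_right M)
    isOpen_Ioo isPreconnected_Ioo
    (fun k y (hy : y ∈ Set.Ioo (x / 2) (2 * x)) =>
      hasDerivAt_expRpowTerm a b c k (show 0 < y by linarith [hy.1]))
    (fun k y hy => ?_) hmem (summable_expRpowTerm a b c hx) hmem
  · convert! h using 1
    rw [tsum_mul_right, mul_comm, Real.exp_eq_exp_ℝ, NormedSpace.exp_eq_tsum_div]
  · have hy0 : 0 < y := by linarith [hy.1]
    rw [norm_mul]
    refine mul_le_mul ?_ (hM y ⟨hy.1.le, hy.2.le⟩) (norm_nonneg _) (by positivity)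
    rw [Real.norm_eq_abs, abs_div, Nat.abs_cast, abs_pow, abs_mul, abs_of_pos hy0]
    gcongr
    exact hy.2.le

lemma injOn_tsum_expRpowTerm (a : ℝ) {b : ℝ} (hb : b ≠ 0) (c : ℝ) :
    Set.InjOn (fun y => ∑' k, expRpowTerm a b c k y) (Set.Ioi 0) := by
  have hcont : ContinuousOn (fun y => ∑' k, expRpowTerm a b c k y) (Set.Ioi 0) := fun y hy =>
    (hasDerivAt_tsum_expRpowTerm a b c hy).continuousAt.continuousWithinAt
  have hpos : ∀ y : ℝ, 0 < y → 0 < y ^ (-a - 1) := fun y hy => Real.rpow_pos_of_pos hy _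
  rcases hb.lt_or_gt with hb | hb
  · refine (strictAntiOn_of_deriv_neg (convex_Ioi 0) hcont fun y hy => ?_).injOn
    rw [interior_Ioi] at hy
    rw [(hasDerivAt_tsum_expRpowTerm a b c hy).deriv]
    exact mul_neg_of_neg_of_pos
      (mul_neg_of_neg_of_pos (inv_lt_zero.mpr hb) (hpos y hy)) (Real.exp_pos _)
  · refine (strictMonoOn_of_deriv_pos (convex_Ioi 0) hcont fun y hy => ?_).injOn
    rw [interior_Ioi] at hy
    rw [(hasDerivAt_tsum_expRpowTerm a b c hy).deriv]
    exact mul_pos (mul_pos (inv_pos.mpr hb) (hpos y hy)) (Real.exp_pos _)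

/-- The derivative of `(G / U) ^ s * exp (-t * (U - G))` along differentiable positive `U`, `G`. -/
lemma HasDerivAt.div_rpow_mul_exp {G U : ℝ → ℝ} {G' U' x : ℝ} (s t : ℝ)
    (hG : HasDerivAt G G' x) (hU : HasDerivAt U U' x) (hGx : 0 < G x) (hUx : 0 < U x) :
    HasDerivAt (fun y => (G y / U y) ^ s * Real.exp (-t * (U y - G y)))
      ((s * (G' / G x - U' / U x) - t * (U' - G')) *
        ((G x / U x) ^ s * Real.exp (-t * (U x - G x)))) x := by
  have hq : 0 < G x / U x := div_pos hGx hUx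
  convert! ((hG.div hU hUx.ne').rpow_const (p := s) (Or.inl hq.ne')).mul
    (((hU.sub hG).const_mul (-t)).exp) using 1
  simp only [Pi.div_apply, Pi.sub_apply]
  rw [Real.rpow_sub_one hq.ne']
  field_simp
  ring


open Real in
/-- The Type II exponential generating function solves the PDE
−βx·F_x + (1−(α+α'x)y)·F_y = (α+γ+(α'+γ')x)·F with F(x,0) = 1, where
F(u,v) = (g(ξ(u,v))/u)^{(α+γ)/β}·exp(−((α'+γ')/β)(u − g(ξ(u,v)))),
ξ(u,v) = v·u^{−α/β}exp(−α'u/β) + Q(u), and g is a local inverse of Q = G⁻¹_{α,β,α'}. -/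
theorem stmt_18 (α β γ α' β' γ' : ℝ) (hβ : β ≠ 0) (hβ' : β' = 0)
    (Q : ℝ → ℝ)
    (hQ : ∀ x : ℝ, Q x = ∑' k : ℕ,
      (if (k : ℝ) = α / β
        then ((-α' / β) ^ k / ((k.factorial : ℝ) * β)) * Real.log x
        else ((-α' / β) ^ k / ((k.factorial : ℝ) * β)) * x ^ ((k : ℝ) - α / β)
              / ((k : ℝ) - α / β)))
    (V : Set ℝ) (hV : IsOpen V)
    (g : ℝ → ℝ) (hg : DifferentiableOn ℝ g V)
    (hgpos : ∀ t ∈ V, 0 < g t) (hgQ : ∀ t ∈ V, Q (g t) = t)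
    (W : Set (ℝ × ℝ)) (hWopen : IsOpen W) (hWpos : ∀ p ∈ W, 0 < p.1)
    (ξ : ℝ × ℝ → ℝ)
    (hξ : ∀ p : ℝ × ℝ, ξ p = p.2 * p.1 ^ (-(α / β)) * Real.exp (-α' * p.1 / β) + Q p.1)
    (hξV : ∀ p ∈ W, ξ p ∈ V)
    (F : ℝ × ℝ → ℝ)
    (hF : ∀ p : ℝ × ℝ, F p = (g (ξ p) / p.1) ^ ((α + γ) / β)
        * Real.exp (-((α' + γ') / β) * (p.1 - g (ξ p)))) :
    (∀ p ∈ W, ∃ Fu Fv : ℝ,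
      HasDerivAt (fun u : ℝ => F (u, p.2)) Fu p.1 ∧
      HasDerivAt (fun v : ℝ => F (p.1, v)) Fv p.2 ∧
      -β * p.1 * Fu + (1 - (α + α' * p.1) * p.2) * Fv
        = (α + γ + (α' + γ') * p.1) * F p) ∧
    (∀ u : ℝ, (u, (0 : ℝ)) ∈ W → F (u, 0) = 1) := by
  have hQ' : Q = fun x => ∑' k, expRpowTerm (α / β) β (-α' / β) k x := funext hQ
  refine ⟨?_, ?_⟩
  · rintro ⟨u, v⟩ hp
    have hu : 0 < u := hWpos _ hp
    have hV' := hξV _ hp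
    have hgd := ((hg _ hV').differentiableAt (hV.mem_nhds hV')).hasDerivAt
    have hgp := hgpos _ hV'
    have hξv : HasDerivAt (fun y => ξ (u, y)) (u ^ (-(α / β)) * Real.exp (-α' * u / β)) v := by
      simp only [hξ]
      simpa using (((hasDerivAt_id v).mul_const (u ^ (-(α / β)))).mul_const
        (Real.exp (-α' * u / β))).add_const (Q u)
    have hξu : HasDerivAt (fun y => ξ (y, v))
        (((1 - (α + α' * u) * v) / (β * u)) * (u ^ (-(α / β)) * Real.exp (-α' * u / β))) u := by
      have hQd : HasDerivAt Q _ u := hQ' ▸ hasDerivAt_tsum_expRpowTerm (α / β) β (-α' / β) hu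
      simp only [hξ]
      convert! ((((Real.hasDerivAt_rpow_const (p := -(α / β)) (Or.inl hu.ne')).const_mul v).mul
        ((((hasDerivAt_id u).const_mul (-α')).div_const β).exp)).add hQd) using 1
      simp only [id]
      rw [Real.rpow_sub_one hu.ne', show -α' / β * u = -α' * u / β by ring]
      field_simp
      ring
    have hFv := HasDerivAt.div_rpow_mul_exp ((α + γ) / β) ((α' + γ') / β)
      (hgd.comp v hξv) (hasDerivAt_const v u) hgp hu
    have hFu := HasDerivAt.div_rpow_mul_exp ((α + γ) / β) ((α' + γ') / β)
      (hgd.comp u hξu) (hasDerivAt_id u) hgp hu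
    simp only [hF]
    refine ⟨_, _, hFu, hFv, ?_⟩
    simp only [Function.comp_apply, id]
    generalize (g (ξ (u, v)) / u) ^ ((α + γ) / β) *
      Real.exp (-((α' + γ') / β) * (u - g (ξ (u, v)))) = E
    field_simp
    ring
  · intro u hu
    have hu0 : 0 < u := hWpos _ hu
    have hξ0 : ξ (u, 0) = Q u := by simp [hξ]
    have hmem : Q u ∈ V := hξ0 ▸ hξV _ hu
    have hgu : g (Q u) = u := by
      refine injOn_tsum_expRpowTerm (α / β) hβ (-α' / β) (hgpos _ hmem) hu0 ?_
      have := hgQ _ hmem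
      rwa [hQ'] at this ⊢
    simp [hF, hξ0, hgu, hu0.ne']
end

section
/- (Type I exponential generating function solves the PDE.) Assume β·β' ≠ 0; set σ := sign(β·β') ∈ {−1,+1}, r := α/β, r' := α'/β', s := (α+γ)/β, s' := −1−(α'+γ')/β'. Let V ⊆ ℝ be open and let g : ℝ → ℝ be differentiable on V with 0 < g(t) < 1 and Q(g(t)) = t for all t ∈ V (so g is a local inverse of Q). Let W be an open subset of (0,1) × ℝ such that ξ(X,Y) := Y·X^{−r}·(1+σ·X)^{r−r'} + Q(X) ∈ V for all (X,Y) ∈ W (real powers), and define 𝓕 on W by 𝓕(X,Y) := (g(ξ(X,Y))/X)^{s} · ((1+σ·X)/(1+σ·g(ξ(X,Y))))^{s+s'}. Then: (i) at every (X,Y) ∈ W, the partial derivatives 𝓕_X and 𝓕_Y exist and −(1+σ·X)·X·𝓕_X(X,Y) + (1−r·Y−σ·r'·X·Y)·𝓕_Y(X,Y) = (s−σ·s'·X)·𝓕(X,Y); (ii) 𝓕(X,0) = 1 whenever (X,0) ∈ W. -/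
theorem HasDerivAt.rpow_const_logDeriv {f : ℝ → ℝ} {f' x : ℝ} (p : ℝ)
    (hf : HasDerivAt f f' x) (hx : 0 < f x) :
    HasDerivAt (fun y => f y ^ p) (f x ^ p * (p * (f' / f x))) x := by
  refine (hf.rpow_const (p := p) (Or.inl hx.ne')).congr_deriv ?_
  rw [Real.rpow_sub hx, Real.rpow_one]
  field_simp

theorem Real.rpow_le_add_rpow_of_mem_Icc {a b x : ℝ} (p : ℝ) (ha : 0 < a) (hx : x ∈ Set.Icc a b) :
    x ^ p ≤ a ^ p + b ^ p := by
  have hxpos : 0 < x := ha.trans_le hx.1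
  have hb : 0 < b := hxpos.trans_le hx.2
  rcases le_total 0 p with hp | hp
  · have := Real.rpow_le_rpow hxpos.le hx.2 hp
    have := Real.rpow_pos_of_pos ha p
    linarith
  · have := Real.rpow_le_rpow_of_nonpos ha hx.1 hp
    have := Real.rpow_pos_of_pos hb p
    linarith

/-- Termwise, these are primitives of `c * x ^ k * x ^ (-r - 1)`, with a logarithm in the resonant
case `k = r`. -/
theorem hasDerivAt_rpow_sub_div_or_log (r c : ℝ) (k : ℕ) {x : ℝ} (hx : 0 < x) :
    HasDerivAt (fun y : ℝ => if (k : ℝ) = r then c * Real.log y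
      else c * y ^ ((k : ℝ) - r) / ((k : ℝ) - r)) (c * x ^ k * x ^ (-r - 1)) x := by
  have hpow : x ^ k * x ^ (-r - 1) = x ^ ((k : ℝ) - r - 1) := by
    rw [← Real.rpow_natCast, ← Real.rpow_add hx]
    ring_nf
  rw [mul_assoc, hpow]
  split_ifs with h
  · refine ((Real.hasDerivAt_log hx.ne').const_mul c).congr_deriv ?_
    rw [h, sub_self, zero_sub, Real.rpow_neg_one]
  · have h' : (k : ℝ) - r ≠ 0 := sub_ne_zero.mpr h
    refine (((Real.hasDerivAt_rpow_const (p := (k : ℝ) - r) (Or.inl hx.ne')).const_mul c).div_const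
      ((k : ℝ) - r)).congr_deriv ?_
    field_simp

theorem hasDerivAt_tsum_rpow_sub_div_or_log (r : ℝ) (c : ℕ → ℝ)
    (hc : ∀ b ∈ Set.Ioo (0 : ℝ) 1, Summable fun k => |c k| * b ^ k)
    {x : ℝ} (hx : x ∈ Set.Ioo (0 : ℝ) 1) :
    HasDerivAt (fun y : ℝ => ∑' k : ℕ, if (k : ℝ) = r then c k * Real.log y
      else c k * y ^ ((k : ℝ) - r) / ((k : ℝ) - r))
      ((∑' k, c k * x ^ k) * x ^ (-r - 1)) x := by
  obtain ⟨a, ha, hax⟩ := exists_between hx.1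
  obtain ⟨b, hxb, hb⟩ := exists_between hx.2
  have hxab : x ∈ Set.Ioo a b := ⟨hax, hxb⟩
  rw [← tsum_mul_right]
  refine hasDerivAt_tsum_of_isPreconnected
    ((hc b ⟨hx.1.trans hxb, hb⟩).mul_right (a ^ (-r - 1) + b ^ (-r - 1)))
    isOpen_Ioo isPreconnected_Ioo
    (fun k y hy => hasDerivAt_rpow_sub_div_or_log r (c k) k (ha.trans hy.1)) ?_ hxab ?_ hxab
  · intro k y hy
    have hy0 : 0 < y := ha.trans hy.1
    rw [norm_mul, norm_mul, norm_pow, Real.norm_eq_abs, Real.norm_of_nonneg hy0.le,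
      Real.norm_of_nonneg (Real.rpow_pos_of_pos hy0 _).le]
    have hb0 : 0 < b := hy0.trans hy.2
    gcongr
    · exact hy.2.le
    · exact Real.rpow_le_add_rpow_of_mem_Icc _ ha ⟨hy.1.le, hy.2.le⟩
  · refine Summable.of_norm_bounded_eventually_nat ((hc x hx).mul_right (x ^ (-r))) ?_
    filter_upwards [Filter.eventually_ge_atTop (⌈r⌉₊ + 1)] with k hk
    have hk' : 1 ≤ (k : ℝ) - r := by
      have h1 : ((⌈r⌉₊ + 1 : ℕ) : ℝ) ≤ k := by exact_mod_cast hk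
      have h2 := Nat.le_ceil r
      push_cast at h1
      linarith
    rw [if_neg (by linarith), norm_div, norm_mul, Real.norm_eq_abs, Real.norm_of_nonneg
      (Real.rpow_pos_of_pos hx.1 _).le, Real.norm_of_nonneg (zero_le_one.trans hk'),
      sub_eq_add_neg (k : ℝ) r, Real.rpow_add hx.1, Real.rpow_natCast, ← mul_assoc,
      ← sub_eq_add_neg]
    exact div_le_self (mul_nonneg (mul_nonneg (abs_nonneg _) (pow_nonneg hx.1.le _))
      (Real.rpow_pos_of_pos hx.1 _).le) hk'

theorem Ring.choose_eq_prod_range_sub_div (a : ℝ) (k : ℕ) :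
    Ring.choose a k = (∏ i ∈ Finset.range k, (a - (i : ℝ))) / (k.factorial : ℝ) := by
  rw [Ring.choose_eq_smul, ← Polynomial.aeval_eq_smeval, Polynomial.aeval_def,
    Polynomial.eval₂_eq_eval_map, descPochhammer_map, descPochhammer_eval_eq_prod_range]
  simp [div_eq_inv_mul]

theorem Real.hasSum_choose_mul_pow (a : ℝ) {x : ℝ} (hx : |x| < 1) :
    HasSum (fun k => Ring.choose a k * x ^ k) ((1 + x) ^ a) := by
  have h := (Real.one_add_rpow_hasFPowerSeriesOnBall_zero (a := a)).hasSum (y := x)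
    (by simpa [enorm_eq_nnnorm, ← NNReal.coe_lt_one] using hx)
  simpa [binomialSeries_apply, -FormalMultilinearSeries.apply_eq_prod_smul_coeff] using h

theorem Real.summable_abs_choose_mul_pow (a : ℝ) {x : ℝ} (hx : x ∈ Set.Ioo (0 : ℝ) 1) :
    Summable fun k => |Ring.choose a k| * x ^ k := by
  have h := (Real.hasSum_choose_mul_pow a (x := x)
    (by rw [abs_of_pos hx.1]; exact hx.2)).summable.abs
  simpa [abs_mul, abs_of_pos hx.1] using h


open Real in
/-- The Type I exponential generating function solves the rescaled PDE
−(1+σX)X·𝓕_X + (1−rY−σr'XY)·𝓕_Y = (s−σs'X)·𝓕 with 𝓕(X,0) = 1, where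
𝓕(X,Y) = (g(ξ(X,Y))/X)^s·((1+σX)/(1+σg(ξ(X,Y))))^{s+s'},
ξ(X,Y) = Y·X^{−r}(1+σX)^{r−r'} + Q(X), and g is a local inverse of Q = G⁻¹_{r,r',σ}. -/
theorem stmt_19 (α β γ α' β' γ' : ℝ) (hββ' : β * β' ≠ 0)
    (σ r r' s s' : ℝ)
    (hσ : σ = Real.sign (β * β'))
    (hr : r = α / β) (hr' : r' = α' / β')
    (hs : s = (α + γ) / β) (hs' : s' = -1 - (α' + γ') / β')
    (binom : ℝ → ℕ → ℝ)
    (hbinom : ∀ (a : ℝ) (k : ℕ),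
      binom a k = (∏ i ∈ Finset.range k, (a - (i : ℝ))) / (k.factorial : ℝ))
    (Q : ℝ → ℝ)
    (hQ : ∀ X : ℝ, Q X = ∑' k : ℕ,
      (if (k : ℝ) = r
        then σ ^ k * binom (r - r' - 1) k * Real.log X
        else σ ^ k * binom (r - r' - 1) k * X ^ ((k : ℝ) - r) / ((k : ℝ) - r)))
    (V : Set ℝ) (hV : IsOpen V)
    (g : ℝ → ℝ) (hg : DifferentiableOn ℝ g V)
    (hgmem : ∀ t ∈ V, 0 < g t ∧ g t < 1) (hgQ : ∀ t ∈ V, Q (g t) = t)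
    (W : Set (ℝ × ℝ)) (hWopen : IsOpen W)
    (hWmem : ∀ p ∈ W, 0 < p.1 ∧ p.1 < 1)
    (ξ : ℝ × ℝ → ℝ)
    (hξ : ∀ p : ℝ × ℝ, ξ p = p.2 * p.1 ^ (-r) * (1 + σ * p.1) ^ (r - r') + Q p.1)
    (hξV : ∀ p ∈ W, ξ p ∈ V)
    (F : ℝ × ℝ → ℝ)
    (hF : ∀ p : ℝ × ℝ, F p = (g (ξ p) / p.1) ^ s
        * ((1 + σ * p.1) / (1 + σ * g (ξ p))) ^ (s + s')) :
    (∀ p ∈ W, ∃ FX FY : ℝ,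
      HasDerivAt (fun X : ℝ => F (X, p.2)) FX p.1 ∧
      HasDerivAt (fun Y : ℝ => F (p.1, Y)) FY p.2 ∧
      -(1 + σ * p.1) * p.1 * FX + (1 - r * p.2 - σ * r' * p.1 * p.2) * FY
        = (s - σ * s' * p.1) * F p) ∧
    (∀ X : ℝ, (X, (0 : ℝ)) ∈ W → F (X, 0) = 1) := by
  have hσ' : σ = -1 ∨ σ = 1 := by
    rw [hσ]
    exact Real.sign_apply_eq_of_ne_zero _ hββ'
  have hσabs : |σ| = 1 := by rcases hσ' with h | h <;> simp [h]
  have hσpos : ∀ x ∈ Set.Ioo (0 : ℝ) 1, 0 < 1 + σ * x := by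
    rintro x ⟨h0, h1⟩
    rcases hσ' with h | h <;> rw [h] <;> linarith
  have hchoose : ∀ a k, binom a k = Ring.choose a k := fun a k => by
    rw [hbinom, Ring.choose_eq_prod_range_sub_div]
  have hQderiv : ∀ x ∈ Set.Ioo (0 : ℝ) 1,
      HasDerivAt Q ((1 + σ * x) ^ (r - r' - 1) * x ^ (-r - 1)) x := by
    intro x hx
    have h := hasDerivAt_tsum_rpow_sub_div_or_log r (fun k => σ ^ k * binom (r - r' - 1) k)
      (fun b hb => by
        simpa [abs_mul, hσabs, hchoose] using Real.summable_abs_choose_mul_pow (r - r' - 1) hb) hx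
    have hsum : ∑' k : ℕ, σ ^ k * binom (r - r' - 1) k * x ^ k = (1 + σ * x) ^ (r - r' - 1) := by
      rw [← (Real.hasSum_choose_mul_pow (r - r' - 1) (x := σ * x)
        (by rw [abs_mul, hσabs, one_mul, abs_of_pos hx.1]; exact hx.2)).tsum_eq]
      refine tsum_congr fun k => ?_
      rw [hchoose, mul_pow]
      ring
    rw [hsum] at h
    rwa [funext hQ]
  have hQinj : Set.InjOn Q (Set.Ioo 0 1) := by
    refine (strictMonoOn_of_deriv_pos (convex_Ioo 0 1)
      (fun x hx => (hQderiv x hx).continuousAt.continuousWithinAt) fun x hx => ?_).injOn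
    rw [interior_Ioo] at hx
    rw [(hQderiv x hx).deriv]
    exact mul_pos (Real.rpow_pos_of_pos (hσpos x hx) _) (Real.rpow_pos_of_pos hx.1 _)
  refine ⟨?_, ?_⟩
  · rintro ⟨x, y⟩ hp
    have hx : x ∈ Set.Ioo (0 : ℝ) 1 := hWmem _ hp
    have hx0 : 0 < x := hx.1
    have hA : 0 < 1 + σ * x := hσpos x hx
    have hG : g (ξ (x, y)) ∈ Set.Ioo (0 : ℝ) 1 := hgmem _ (hξV _ hp)
    have hG0 : 0 < g (ξ (x, y)) := hG.1
    have hB : 0 < 1 + σ * g (ξ (x, y)) := hσpos _ hG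
    obtain ⟨g', hg'⟩ : ∃ g', HasDerivAt g g' (ξ (x, y)) :=
      ⟨_, ((hg _ (hξV _ hp)).differentiableAt (hV.mem_nhds (hξV _ hp))).hasDerivAt⟩
    have hlin : HasDerivAt (fun u : ℝ => 1 + σ * u) σ x := by
      simpa using ((hasDerivAt_id x).const_mul σ).const_add 1
    set E : ℝ := x ^ (-r) * (1 + σ * x) ^ (r - r') with hE
    have hξX : HasDerivAt (fun u : ℝ => ξ (u, y))
        (E * (y * (-r / x + (r - r') * σ / (1 + σ * x)) + 1 / (x * (1 + σ * x)))) x := by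
      rw [funext fun u => hξ (u, y)]
      refine ((((HasDerivAt.rpow_const_logDeriv (-r) (hasDerivAt_id x) hx0).const_mul y).mul
        (HasDerivAt.rpow_const_logDeriv (r - r') hlin hA)).add (hQderiv x hx)).congr_deriv ?_
      rw [Real.rpow_sub_one hA.ne', Real.rpow_sub_one hx0.ne', hE]
      simp only [id]
      field_simp
    have hξY : HasDerivAt (fun u : ℝ => ξ (x, u)) E y := by
      rw [funext fun u => hξ (x, u)]
      refine ((((hasDerivAt_id y).mul_const (x ^ (-r))).mul_const
        ((1 + σ * x) ^ (r - r'))).add_const (Q x)).congr_deriv ?_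
      rw [hE, one_mul]
    have hGX := hg'.comp x hξX
    have hGY := hg'.comp y hξY
    have hFX := (HasDerivAt.rpow_const_logDeriv s
      (hGX.div (hasDerivAt_id x) hx0.ne') (div_pos hG0 hx0)).mul
      (HasDerivAt.rpow_const_logDeriv (s + s')
        (hlin.div ((hGX.const_mul σ).const_add 1) hB.ne') (div_pos hA hB))
    have hFY := (HasDerivAt.rpow_const_logDeriv s
      (hGY.div_const x) (div_pos hG0 hx0)).mul
      (HasDerivAt.rpow_const_logDeriv (s + s')
        ((hasDerivAt_const y (1 + σ * x)).div ((hGY.const_mul σ).const_add 1) hB.ne')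
        (div_pos hA hB))
    refine ⟨_, _, hFX.congr_of_eventuallyEq (.of_forall fun u => hF (u, y)),
      hFY.congr_of_eventuallyEq (.of_forall fun u => hF (x, u)), ?_⟩
    rw [hF]
    simp only [Function.comp, Pi.div_apply, id]
    generalize g (ξ (x, y)) = G at *
    generalize (G / x) ^ s = P
    generalize ((1 + σ * x) / (1 + σ * G)) ^ (s + s') = R
    clear_value E
    have hA' := hA.ne'
    have hB' := hB.ne'
    field_simp
    ring
  · intro x hp
    have hx : x ∈ Set.Ioo (0 : ℝ) 1 := hWmem _ hp
    have hξ0 : ξ (x, 0) = Q x := by simp [hξ]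
    have hGx : g (ξ (x, 0)) = x :=
      hQinj (hgmem _ (hξV _ hp)) hx ((hgQ _ (hξV _ hp)).trans hξ0)
    rw [hF, hGx, div_self hx.1.ne', div_self (hσpos x hx).ne', Real.one_rpow, Real.one_rpow,
      one_mul]
end
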